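/- arXiv:math/0702897 — 2 statements merged into one kernel-verified Lean document; each statement's English description precedes it below -/
import Mathlib

section
/- Let K be a compact convex set in ℝ² with nonempty interior. Then P_K² − 4π·A_K ≥ π²·(R_K − r_K)², where A_K is the area of K, P_K its perimeter, R_K its circumradius, and r_K its inradius. -/
open MeasureTheory Metric Real


/-- The area (Lebesgue measure) of a subset of the Euclidean plane. -/
noncomputable def euclArea (K : Set (EuclideanSpace ℝ (Fin 2))) : ℝ :=
  (volume K).toReal

/-- The perimeter: one-dimensional Hausdorff measure of the topological boundary. -/
noncomputable def euclPerim (K : Set (EuclideanSpace ℝ (Fin 2))) : ℝ :=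
  (μH[1] (frontier K)).toReal

/-- The circumradius: infimum of radii of closed discs containing `K`. -/
noncomputable def euclCircumradius (K : Set (EuclideanSpace ℝ (Fin 2))) : ℝ :=
  sInf {R : ℝ | ∃ c, K ⊆ closedBall c R}

/-- The inradius: supremum of radii of closed discs contained in `K`. -/
noncomputable def euclInradius (K : Set (EuclideanSpace ℝ (Fin 2))) : ℝ :=
  sSup {r : ℝ | ∃ c, closedBall c r ⊆ K}
/-! ### Part 1: the analytic inequality on one arc -/

noncomputable def circPrim (t : ℝ) (x : ℝ) : ℝ := ∫ s in (0:ℝ)..x, √(t ^ 2 - s ^ 2)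

lemma circPrim_hasDerivAt (t x : ℝ) : HasDerivAt (circPrim t) (√(t ^ 2 - x ^ 2)) x := by
  have hc : Continuous fun s : ℝ => √(t ^ 2 - s ^ 2) := by fun_prop
  exact intervalIntegral.integral_hasDerivAt_right (hc.intervalIntegrable _ _)
    (hc.stronglyMeasurableAtFilter _ _) hc.continuousAt

lemma circPrim_lipschitz {t : ℝ} (ht : 0 ≤ t) : LipschitzWith t.toNNReal (circPrim t) := by
  apply lipschitzWith_of_nnnorm_deriv_le
  · exact fun x => (circPrim_hasDerivAt t x).differentiableAt
  · intro x
    rw [(circPrim_hasDerivAt t x).deriv, ← NNReal.coe_le_coe]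
    rw [coe_nnnorm, norm_eq_abs, Real.coe_toNNReal t ht]
    rw [abs_of_nonneg (Real.sqrt_nonneg _)]
    apply Real.sqrt_le_iff.2
    exact ⟨ht, by nlinarith [sq_nonneg x]⟩

lemma circPrim_sin {t : ℝ} (ht : 0 ≤ t) {v : ℝ} (hv0 : 0 ≤ v) (hv : v ≤ π / 2) :
    circPrim t (t * sin v) = t ^ 2 / 2 * (v + sin v * cos v) := by
  have key : ∀ y ∈ Set.Icc 0 v, (fun v => circPrim t (t * sin v)) y =
      (fun v => t ^ 2 / 2 * (v + sin v * cos v)) y := by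
    apply eq_of_has_deriv_right_eq (f' := fun v => t ^ 2 * cos v ^ 2)
    · intro y hy
      have h1 : HasDerivAt (fun v => t * sin v) (t * cos y) y :=
        (Real.hasDerivAt_sin y).const_mul t
      have h2 := (circPrim_hasDerivAt t (t * sin y)).comp y h1
      have h3 : √(t ^ 2 - (t * sin y) ^ 2) = t * cos y := by
        rw [show t ^ 2 - (t * sin y) ^ 2 = (t * cos y) ^ 2 by
          have := sin_sq_add_cos_sq y
          linear_combination (-t^2) * this]
        apply Real.sqrt_sq
        apply mul_nonneg ht
        apply cos_nonneg_of_mem_Icc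
        constructor <;> linarith [hy.1, hy.2, pi_pos]
      rw [h3] at h2
      have h4 : t * cos y * (t * cos y) = t ^ 2 * cos y ^ 2 := by ring
      rw [h4] at h2
      exact h2.hasDerivWithinAt
    · intro y hy
      have h1 := ((hasDerivAt_id y).add ((Real.hasDerivAt_sin y).mul
        (Real.hasDerivAt_cos y))).const_mul (t ^ 2 / 2)
      have h4 : t ^ 2 / 2 * (1 + (cos y * cos y + sin y * -sin y)) = t ^ 2 * cos y ^ 2 := by
        have := sin_sq_add_cos_sq y
        linear_combination (-t ^ 2 / 2) * this
      rw [h4] at h1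
      exact h1.hasDerivWithinAt
    · apply Continuous.continuousOn
      exact (circPrim_lipschitz ht).continuous.comp (by fun_prop)
    · apply Continuous.continuousOn
      fun_prop
    · simp [circPrim]
  exact key v ⟨hv0, le_rfl⟩

lemma circPrim_neg (t x : ℝ) : circPrim t (-x) = - circPrim t x := by
  unfold circPrim
  have := intervalIntegral.integral_comp_neg (a := 0) (b := x) (fun s : ℝ => √(t ^ 2 - s ^ 2))
  simp only [neg_sq, neg_zero] at this
  rw [this, intervalIntegral.integral_symm]

lemma le_of_ac_deriv_nonneg {f : ℝ → ℝ} {a b : ℝ} (hab : a ≤ b)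
    (hf : AbsolutelyContinuousOnInterval f a b)
    (h : ∀ᵐ x, x ∈ Set.Ioo a b → 0 ≤ deriv f x) : f a ≤ f b := by
  have h1 := hf.integral_deriv_eq_sub
  have h2 : 0 ≤ ∫ x in a..b, deriv f x := by
    rw [intervalIntegral.integral_of_le hab, integral_Ioc_eq_integral_Ioo]
    apply setIntegral_nonneg_of_ae_restrict
    rw [Filter.EventuallyLE, ae_restrict_iff' measurableSet_Ioo]
    exact h
  linarith

lemma arc_frame {x y w k l : ℝ → ℝ} {a b t g : ℝ} {Cx Cy Ck Cl : NNReal} (hab : a ≤ b)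
    (ht : 0 < t) (hg0 : 0 ≤ g) (hg : g ≤ π)
    (hx : LipschitzWith Cx x) (hy : LipschitzWith Cy y) (hk : LipschitzWith Ck k)
    (hl : LipschitzOnWith Cl l (Set.Icc a b)) (hw : Continuous w)
    (hd : ∀ᵐ θ : ℝ, ∀ dx dy dk, HasDerivAt x dx θ → HasDerivAt y dy θ → HasDerivAt k dk θ →
      x θ * dy - y θ * dx = w θ + dk)
    (hlen : ∀ α ∈ Set.Icc a b, ∀ β ∈ Set.Icc a b, α ≤ β →
      √((x β - x α) ^ 2 + (y β - y α) ^ 2) ≤ l β - l α)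
    (hstrip : ∀ θ ∈ Set.Icc a b, |x θ| ≤ t)
    (hxa : x a = t * sin (g / 2)) (hxb : x b = - (t * sin (g / 2)))
    (hya : y a = t * cos (g / 2)) (hyb : y b = t * cos (g / 2)) :
    (1 / 2) * (∫ θ in a..b, w θ) + (1 / 2) * (k b - k a) + (1 / 2) * t ^ 2 * g
      ≤ t * (l b - l a) := by
  set G : ℝ → ℝ := fun θ => (1 / 2) * (∫ s in a..θ, w s) + (1 / 2) * k θ + (1 / 2) * (x θ * y θ)
    - circPrim t (x θ) with hG
  have acx : AbsolutelyContinuousOnInterval x a b :=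
    (hx.lipschitzOnWith (s := Set.uIcc a b)).absolutelyContinuousOnInterval
  have acy : AbsolutelyContinuousOnInterval y a b :=
    (hy.lipschitzOnWith (s := Set.uIcc a b)).absolutelyContinuousOnInterval
  have ack : AbsolutelyContinuousOnInterval k a b :=
    (hk.lipschitzOnWith (s := Set.uIcc a b)).absolutelyContinuousOnInterval
  have acF : AbsolutelyContinuousOnInterval (fun θ => circPrim t (x θ)) a b :=
    (((circPrim_lipschitz ht.le).comp hx).lipschitzOnWith
      (s := Set.uIcc a b)).absolutelyContinuousOnInterval
  have acl : AbsolutelyContinuousOnInterval l a b := by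
    rw [← Set.uIcc_of_le hab] at hl
    exact hl.absolutelyContinuousOnInterval
  have acw : AbsolutelyContinuousOnInterval (fun θ => ∫ s in a..θ, w s) a b :=
    (hw.intervalIntegrable a b).absolutelyContinuousOnInterval_intervalIntegral (by simp)
  have acG : AbsolutelyContinuousOnInterval G a b :=
    (((acw.const_mul (1/2)).add (ack.const_mul (1/2))).add
      ((acx.mul acy).const_mul (1/2))).sub acF
  have acPsi : AbsolutelyContinuousOnInterval (fun θ => t * l θ - G θ) a b :=
    (acl.const_mul t).sub acG
  have main := le_of_ac_deriv_nonneg hab acPsi ?_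
  · have e1 : G b - G a = (1 / 2) * (∫ θ in a..b, w θ) + (1 / 2) * (k b - k a)
        + (1 / 2) * t ^ 2 * g := by
      simp only [hG, hxa, hxb, hya, hyb, circPrim_neg]
      rw [circPrim_sin ht.le (by linarith) (by linarith)]
      simp
      ring
    linarith
  · filter_upwards [hd, acx.ae_differentiableAt, acy.ae_differentiableAt,
      ack.ae_differentiableAt, acl.ae_differentiableAt] with θ hdθ h1 h2 h3 h4 hθ
    have hθ' : θ ∈ Set.uIcc a b := by
      rw [Set.uIcc_of_le hab]; exact Set.Ioo_subset_Icc_self hθ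
    have hx' := (h1 hθ').hasDerivAt
    have hy' := (h2 hθ').hasDerivAt
    have hk' := (h3 hθ').hasDerivAt
    have hl' := (h4 hθ').hasDerivAt
    set dx := deriv x θ
    set dy := deriv y θ
    set dk := deriv k θ
    set dl := deriv l θ
    have hrel := hdθ dx dy dk hx' hy' hk'
    have hw' : HasDerivAt (fun θ => ∫ s in a..θ, w s) (w θ) θ :=
      intervalIntegral.integral_hasDerivAt_right (hw.intervalIntegrable _ _)
        (hw.stronglyMeasurableAtFilter _ _) hw.continuousAt
    have hF' := (circPrim_hasDerivAt t (x θ)).comp θ hx'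
    have hG' := (((hw'.const_mul (1/2)).add (hk'.const_mul (1/2))).add
      ((hx'.mul hy').const_mul (1/2))).sub hF'
    have hP := (hl'.const_mul t).sub hG'
    have hder : deriv (fun θ => t * l θ - G θ) θ = _ := hP.deriv
    rw [hder]
    set S := √(t ^ 2 - (x θ) ^ 2) with hS
    have hx2 : (x θ) ^ 2 ≤ t ^ 2 := by
      have := hstrip θ (Set.Ioo_subset_Icc_self hθ)
      exact sq_le_sq' (abs_le.1 this).1 (abs_le.1 this).2
    have hS2 : S ^ 2 = t ^ 2 - (x θ) ^ 2 := Real.sq_sqrt (by linarith)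
    -- monotone comparison
    set A := x θ with hA
    have hmono : MonotoneOn (fun τ => t * l τ - (A * y τ - S * x τ)) (Set.Icc a b) := by
      intro α hα β hβ hαβ
      have h5 := hlen α hα β hβ hαβ
      set D := √((x β - x α) ^ 2 + (y β - y α) ^ 2) with hD
      have hD2 : D ^ 2 = (x β - x α) ^ 2 + (y β - y α) ^ 2 := Real.sq_sqrt (by positivity)
      have hD0 : 0 ≤ D := Real.sqrt_nonneg _
      have h6 : A * (y β - y α) - S * (x β - x α) ≤ t * D := by
        refine (le_abs_self _).trans (abs_le_of_sq_le_sq (b := t * D) ?_ (by positivity))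
        rw [mul_pow, hD2]
        have : t ^ 2 = A ^ 2 + S ^ 2 := by rw [hS2]; ring
        rw [this]
        nlinarith [sq_nonneg (A * (x β - x α) + S * (y β - y α))]
      have h7 : t * D ≤ t * (l β - l α) := mul_le_mul_of_nonneg_left h5 ht.le
      simp only
      linarith
    have hder2 := (hl'.const_mul t).sub ((hy'.const_mul A).sub (hx'.const_mul S))
    have huniq : UniqueDiffWithinAt ℝ (Set.Icc a b) θ :=
      uniqueDiffOn_Icc (hθ.1.trans hθ.2) θ (Set.Ioo_subset_Icc_self hθ)
    have hnn := hmono.derivWithin_nonneg (x := θ)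
    have hval : derivWithin (fun τ => t * l τ - (A * y τ - S * x τ)) (Set.Icc a b) θ = _ :=
      hder2.hasDerivWithinAt.derivWithin huniq
    rw [hval] at hnn
    linarith

/-! ### Part 2: the analytic inequality for a closed curve in polar form -/

lemma lip_lin {f g : ℝ → ℝ} {C D : NNReal} (hf : LipschitzWith C f) (hg : LipschitzWith D g)
    (A B c : ℝ) : ∃ E : NNReal, LipschitzWith E (fun θ => A * f θ + B * g θ + c) := by
  refine ⟨A.nnabs * C + B.nnabs * D, LipschitzWith.of_dist_le_mul fun x y => ?_⟩
  have h1 := hf.dist_le_mul x y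
  have h2 := hg.dist_le_mul x y
  rw [Real.dist_eq] at h1 h2 ⊢
  push_cast
  have e : A * f x + B * g x + c - (A * f y + B * g y + c)
    = A * (f x - f y) + B * (g x - g y) := by ring
  rw [e]
  calc _ ≤ |A * (f x - f y)| + |B * (g x - g y)| := abs_add_le _ _
    _ = |A| * |f x - f y| + |B| * |g x - g y| := by rw [abs_mul, abs_mul]
    _ ≤ |A| * (C * dist x y) + |B| * (D * dist x y) := by gcongr
    _ = _ := by ring

lemma arc_polar {ρ l : ℝ → ℝ} {Cr C0 C1 Cl : NNReal} (hρ : LipschitzWith Cr ρ)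
    (h0 : LipschitzWith C0 (fun θ => ρ θ * cos θ)) (h1 : LipschitzWith C1 (fun θ => ρ θ * sin θ))
    {q0 q1 a b t φa φb : ℝ} (hab : a ≤ b) (ht : 0 < t) (hφ : φa ≤ φb) (hφ' : φb ≤ φa + π)
    (hl : LipschitzOnWith Cl l (Set.Icc a b))
    (hlen : ∀ α ∈ Set.Icc a b, ∀ β ∈ Set.Icc a b, α ≤ β →
      √((ρ β * cos β - ρ α * cos α) ^ 2 + (ρ β * sin β - ρ α * sin α) ^ 2) ≤ l β - l α)
    (hstrip : ∀ θ ∈ Set.Icc a b, |(ρ θ * cos θ - q0) * sin ((φa + φb) / 2)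
      - (ρ θ * sin θ - q1) * cos ((φa + φb) / 2)| ≤ t)
    (ha0 : ρ a * cos a = q0 + t * cos φa) (ha1 : ρ a * sin a = q1 + t * sin φa)
    (hb0 : ρ b * cos b = q0 + t * cos φb) (hb1 : ρ b * sin b = q1 + t * sin φb) :
    (1 / 2) * (∫ θ in a..b, ρ θ ^ 2)
      + (1 / 2) * ((q1 * (ρ b * cos b) - q0 * (ρ b * sin b))
        - (q1 * (ρ a * cos a) - q0 * (ρ a * sin a)))
      + (1 / 2) * t ^ 2 * (φb - φa) ≤ t * (l b - l a) := by
  set m := (φa + φb) / 2 with hm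
  have hcs := sin_sq_add_cos_sq m
  obtain ⟨Cx, hx⟩ := lip_lin h0 h1 (sin m) (-cos m) (- q0 * sin m + q1 * cos m)
  obtain ⟨Cy, hy⟩ := lip_lin h0 h1 (cos m) (sin m) (- q0 * cos m - q1 * sin m)
  obtain ⟨Ck, hk⟩ := lip_lin h0 h1 q1 (-q0) 0
  have ea : φa = m - (φb - φa) / 2 := by rw [hm]; ring
  have eb : φb = m + (φb - φa) / 2 := by rw [hm]; ring
  have key := arc_frame (w := fun θ => ρ θ ^ 2) (g := φb - φa) (l := l) hab ht (by linarith)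
    (by linarith) hx hy hk hl (hρ.continuous.pow 2) ?_ ?_ ?_ ?_ ?_ ?_ ?_
  · refine le_trans (le_of_eq ?_) key
    ring
  · filter_upwards [hρ.ae_differentiableAt_real] with θ hθ dx dy dk hdx hdy hdk
    have hr := hθ.hasDerivAt
    set dr := deriv ρ θ
    have hc := hr.mul (Real.hasDerivAt_cos θ)
    have hs := hr.mul (Real.hasDerivAt_sin θ)
    have ex := hdx.unique (((hc.const_mul (sin m)).add (hs.const_mul (-cos m))).add_const _)
    have ey := hdy.unique (((hc.const_mul (cos m)).add (hs.const_mul (sin m))).add_const _)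
    have ek := hdk.unique (((hc.const_mul q1).add (hs.const_mul (-q0))).add_const _)
    have hcs2 := sin_sq_add_cos_sq θ
    rw [ex, ey, ek]
    have e1 : ∀ X Y dX dY : ℝ, (sin m * X + -cos m * Y + (-q0 * sin m + q1 * cos m)) *
        (cos m * dX + sin m * dY) - (cos m * X + sin m * Y + (-q0 * cos m - q1 * sin m)) *
        (sin m * dX + - cos m * dY) = (X - q0) * dY - (Y - q1) * dX := by
      intro X Y dX dY
      linear_combination ((X - q0) * dY - (Y - q1) * dX) * hcs
    rw [e1]
    linear_combination (ρ θ ^ 2) * hcs2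
  · intro α hα β hβ hαβ
    refine le_trans (le_of_eq ?_) (hlen α hα β hβ hαβ)
    congr 1
    linear_combination ((ρ β * cos β - ρ α * cos α) ^ 2 + (ρ β * sin β - ρ α * sin α) ^ 2) * hcs
  · intro θ hθ
    refine le_trans (le_of_eq ?_) (hstrip θ hθ)
    congr 1
    ring
  · have e : sin ((φb - φa) / 2) = sin (m - φa) := by congr 1; rw [hm]; ring
    simp only [ha0, ha1, e, sin_sub]; ring
  · have e : sin ((φb - φa) / 2) = sin (φb - m) := by congr 1; rw [hm]; ring
    simp only [hb0, hb1, e, sin_sub]; ring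
  · have e : cos ((φb - φa) / 2) = cos (m - φa) := by congr 1; rw [hm]; ring
    simp only [ha0, ha1, e, cos_sub]; ring
  · have e : cos ((φb - φa) / 2) = cos (φb - m) := by congr 1; rw [hm]; ring
    simp only [hb0, hb1, e, cos_sub]; ring

lemma loop_polar {ρ l : ℝ → ℝ} {Cr C0 C1 Cl : NNReal} (hρ : LipschitzWith Cr ρ)
    (h0 : LipschitzWith C0 (fun θ => ρ θ * cos θ)) (h1 : LipschitzWith C1 (fun θ => ρ θ * sin θ))
    (hper : ∀ θ, ρ (θ + 2 * π) = ρ θ)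
    {q0 q1 t : ℝ} (θ φ : Fin 3 → ℝ) (ht : 0 < t)
    (hθ1 : θ 0 ≤ θ 1) (hθ2 : θ 1 ≤ θ 2) (hθ3 : θ 2 ≤ θ 0 + 2 * π)
    (hφ1 : φ 0 ≤ φ 1) (hφ2 : φ 1 ≤ φ 2) (hφ3 : φ 2 ≤ φ 0 + 2 * π)
    (hφ1' : φ 1 ≤ φ 0 + π) (hφ2' : φ 2 ≤ φ 1 + π) (hφ3' : φ 0 + 2 * π ≤ φ 2 + π)
    (hl : LipschitzOnWith Cl l (Set.Icc (θ 0) (θ 0 + 2 * π)))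
    (hlen : ∀ α ∈ Set.Icc (θ 0) (θ 0 + 2 * π), ∀ β ∈ Set.Icc (θ 0) (θ 0 + 2 * π), α ≤ β →
      √((ρ β * cos β - ρ α * cos α) ^ 2 + (ρ β * sin β - ρ α * sin α) ^ 2) ≤ l β - l α)
    (hstrip1 : ∀ s ∈ Set.Icc (θ 0) (θ 1), |(ρ s * cos s - q0) * sin ((φ 0 + φ 1) / 2)
      - (ρ s * sin s - q1) * cos ((φ 0 + φ 1) / 2)| ≤ t)
    (hstrip2 : ∀ s ∈ Set.Icc (θ 1) (θ 2), |(ρ s * cos s - q0) * sin ((φ 1 + φ 2) / 2)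
      - (ρ s * sin s - q1) * cos ((φ 1 + φ 2) / 2)| ≤ t)
    (hstrip3 : ∀ s ∈ Set.Icc (θ 2) (θ 0 + 2 * π),
      |(ρ s * cos s - q0) * sin ((φ 2 + (φ 0 + 2 * π)) / 2)
      - (ρ s * sin s - q1) * cos ((φ 2 + (φ 0 + 2 * π)) / 2)| ≤ t)
    (hc0 : ∀ i, ρ (θ i) * cos (θ i) = q0 + t * cos (φ i))
    (hc1 : ∀ i, ρ (θ i) * sin (θ i) = q1 + t * sin (φ i)) :
    (1 / 2) * (∫ s in (θ 0)..(θ 0 + 2 * π), ρ s ^ 2) + π * t ^ 2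
      ≤ t * (l (θ 0 + 2 * π) - l (θ 0)) := by
  have pp := pi_pos
  have sub1 : Set.Icc (θ 0) (θ 1) ⊆ Set.Icc (θ 0) (θ 0 + 2 * π) :=
    Set.Icc_subset_Icc le_rfl (by linarith)
  have sub2 : Set.Icc (θ 1) (θ 2) ⊆ Set.Icc (θ 0) (θ 0 + 2 * π) :=
    Set.Icc_subset_Icc (by linarith) (by linarith)
  have sub3 : Set.Icc (θ 2) (θ 0 + 2 * π) ⊆ Set.Icc (θ 0) (θ 0 + 2 * π) :=
    Set.Icc_subset_Icc (by linarith) (by linarith)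
  have A1 := arc_polar hρ h0 h1 (q0 := q0) (q1 := q1) hθ1 ht hφ1 hφ1' (hl.mono sub1)
    (fun α hα β hβ h => hlen α (sub1 hα) β (sub1 hβ) h) hstrip1 (hc0 0) (hc1 0) (hc0 1) (hc1 1)
  have A2 := arc_polar hρ h0 h1 (q0 := q0) (q1 := q1) hθ2 ht hφ2 hφ2' (hl.mono sub2)
    (fun α hα β hβ h => hlen α (sub2 hα) β (sub2 hβ) h) hstrip2 (hc0 1) (hc1 1) (hc0 2) (hc1 2)
  have ec : ρ (θ 0 + 2 * π) * cos (θ 0 + 2 * π) = ρ (θ 0) * cos (θ 0) := by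
    rw [hper, cos_add_two_pi]
  have es : ρ (θ 0 + 2 * π) * sin (θ 0 + 2 * π) = ρ (θ 0) * sin (θ 0) := by
    rw [hper, sin_add_two_pi]
  have A3 := arc_polar hρ h0 h1 (q0 := q0) (q1 := q1) hθ3 ht hφ3 hφ3' (hl.mono sub3)
    (fun α hα β hβ h => hlen α (sub3 hα) β (sub3 hβ) h) hstrip3 (hc0 2) (hc1 2)
    (by rw [ec, hc0, cos_add_two_pi]) (by rw [es, hc1, sin_add_two_pi])
  rw [ec, es] at A3
  have hi : ∀ a b, IntervalIntegrable (fun s => ρ s ^ 2) volume a b := fun a b =>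
    (hρ.continuous.pow 2).intervalIntegrable a b
  have I1 := intervalIntegral.integral_add_adjacent_intervals (hi (θ 0) (θ 1)) (hi (θ 1) (θ 2))
  have I2 := intervalIntegral.integral_add_adjacent_intervals (hi (θ 0) (θ 2))
    (hi (θ 2) (θ 0 + 2 * π))
  rw [← I2, ← I1]
  linarith

/-! ### Part 3: polar parametrization of the boundary -/

/-- Unit vector with angle `θ`. -/
noncomputable def uv (θ : ℝ) : EuclideanSpace ℝ (Fin 2) := !₂[cos θ, sin θ]

/-- Radial function of `K` about the origin. -/
noncomputable def polR (K : Set (EuclideanSpace ℝ (Fin 2))) (θ : ℝ) : ℝ := (gauge K (uv θ))⁻¹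

/-- Boundary curve. -/
noncomputable def polC (K : Set (EuclideanSpace ℝ (Fin 2))) (θ : ℝ) : EuclideanSpace ℝ (Fin 2) :=
  polR K θ • uv θ

lemma uv_zero (θ : ℝ) : uv θ 0 = cos θ := by simp [uv]
lemma uv_one (θ : ℝ) : uv θ 1 = sin θ := by simp [uv]

lemma eucl_norm (x : EuclideanSpace ℝ (Fin 2)) : ‖x‖ = √(x 0 ^ 2 + x 1 ^ 2) := by
  rw [EuclideanSpace.norm_eq]; simp

lemma eucl_norm_sq (x : EuclideanSpace ℝ (Fin 2)) : ‖x‖ ^ 2 = x 0 ^ 2 + x 1 ^ 2 := by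
  rw [eucl_norm, Real.sq_sqrt (by positivity)]

lemma eucl_inner (x y : EuclideanSpace ℝ (Fin 2)) : inner ℝ x y = x 0 * y 0 + x 1 * y 1 := by
  simp [PiLp.inner_apply, mul_comm]

lemma uv_norm (θ : ℝ) : ‖uv θ‖ = 1 := by
  rw [eucl_norm, uv_zero, uv_one]; simp

lemma uv_ne (θ : ℝ) : uv θ ≠ 0 := by
  intro h; have := uv_norm θ; simp [h] at this

lemma uv_periodic (θ : ℝ) : uv (θ + 2 * π) = uv θ := by simp [uv]

lemma uv_lipschitz : LipschitzWith 1 uv := by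
  apply LipschitzWith.of_dist_le_mul
  intro a b
  rw [dist_eq_norm, Real.dist_eq, NNReal.coe_one, one_mul]
  refine abs_le_of_sq_le_sq' ?_ (abs_nonneg _) |>.2
  rw [eucl_norm_sq, sq_abs]
  simp only [PiLp.sub_apply, uv_zero, uv_one]
  have h1 := sin_sq_add_cos_sq a
  have h2 := sin_sq_add_cos_sq b
  have h3 : cos (a - b) ≥ 1 - (a - b) ^ 2 / 2 := one_sub_sq_div_two_le_cos
  rw [cos_sub] at h3
  nlinarith

lemma exists_angle (x : EuclideanSpace ℝ (Fin 2)) : ∃ θ, x = ‖x‖ • uv θ := by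
  refine ⟨Complex.arg ⟨x 0, x 1⟩, ?_⟩
  have hn : ‖x‖ = ‖(⟨x 0, x 1⟩ : ℂ)‖ := by
    rw [eucl_norm, Complex.norm_eq_sqrt_sq_add_sq]
  ext i
  fin_cases i
  · simp [uv, hn, Complex.norm_mul_cos_arg]
  · simp [uv, hn, Complex.norm_mul_sin_arg]

lemma exists_angle_ge (x : EuclideanSpace ℝ (Fin 2)) (a : ℝ) :
    ∃ θ ∈ Set.Ico a (a + 2 * π), x = ‖x‖ • uv θ := by
  obtain ⟨θ, hθ⟩ := exists_angle x
  have hp : Function.Periodic uv (2 * π) := uv_periodic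
  obtain ⟨y, hy, hy'⟩ := hp.exists_mem_Ico (by positivity) θ a
  exact ⟨y, hy, by rw [← hy', ← hθ]⟩

lemma uv_inj {a α β : ℝ} (hα : α ∈ Set.Ico a (a + 2 * π)) (hβ : β ∈ Set.Ico a (a + 2 * π))
    (h : uv α = uv β) : α = β := by
  have h0 : cos α = cos β := by rw [← uv_zero, h, uv_zero]
  have h1 : sin α = sin β := by rw [← uv_one, h, uv_one]
  have h2 : cos (α - β) = 1 := by
    rw [cos_sub, h0, h1]; nlinarith [sin_sq_add_cos_sq β]
  have h3 := (cos_eq_one_iff_of_lt_of_lt (x := α - β) (by linarith [hα.1, hβ.2])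
    (by linarith [hα.2, hβ.1])).1 h2
  linarith

section geom
variable {K : Set (EuclideanSpace ℝ (Fin 2))}

lemma gauge_uv_pos (hc : IsCompact K) (h0 : K ∈ nhds 0) (θ : ℝ) : 0 < gauge K (uv θ) :=
  (gauge_pos (absorbent_nhds_zero h0) (NormedSpace.isVonNBounded_of_isBounded ℝ hc.isBounded)).2
    (uv_ne θ)

lemma polR_pos (hc : IsCompact K) (h0 : K ∈ nhds 0) (θ : ℝ) : 0 < polR K θ :=
  inv_pos.2 (gauge_uv_pos hc h0 θ)

lemma polR_periodic (θ : ℝ) : polR K (θ + 2 * π) = polR K θ := by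
  simp [polR, uv_periodic]

lemma polC_periodic (θ : ℝ) : polC K (θ + 2 * π) = polC K θ := by
  simp [polC, polR_periodic, uv_periodic]

lemma polC_zero (θ : ℝ) : polC K θ 0 = polR K θ * cos θ := by simp [polC, uv]
lemma polC_one (θ : ℝ) : polC K θ 1 = polR K θ * sin θ := by simp [polC, uv]

lemma smul_uv_mem_iff (hc : IsCompact K) (hK : Convex ℝ K) (h0 : K ∈ nhds 0) {s : ℝ} (hs : 0 ≤ s)
    (θ : ℝ) : s • uv θ ∈ K ↔ s ≤ polR K θ := by
  rw [← hc.isClosed.closure_eq, ← gauge_le_one_iff_mem_closure hK h0, gauge_smul_of_nonneg hs,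
    hc.isClosed.closure_eq, polR, smul_eq_mul, ← le_div_iff₀ (gauge_uv_pos hc h0 θ), one_div]

lemma smul_uv_mem_frontier_iff (hc : IsCompact K) (hK : Convex ℝ K) (h0 : K ∈ nhds 0) {s : ℝ}
    (hs : 0 ≤ s) (θ : ℝ) : s • uv θ ∈ frontier K ↔ s = polR K θ := by
  rw [← gauge_eq_one_iff_mem_frontier hK h0, gauge_smul_of_nonneg hs, polR, smul_eq_mul,
    ← eq_div_iff (gauge_uv_pos hc h0 θ).ne', one_div]

lemma polC_mem_frontier (hc : IsCompact K) (hK : Convex ℝ K) (h0 : K ∈ nhds 0) (θ : ℝ) :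
    polC K θ ∈ frontier K :=
  (smul_uv_mem_frontier_iff hc hK h0 (polR_pos hc h0 θ).le θ).2 rfl

lemma frontier_exists (hc : IsCompact K) (hK : Convex ℝ K) (h0 : K ∈ nhds 0)
    {p : EuclideanSpace ℝ (Fin 2)} (hp : p ∈ frontier K) (a : ℝ) :
    ∃ θ ∈ Set.Ico a (a + 2 * π), p = polC K θ := by
  obtain ⟨θ, hθ, h⟩ := exists_angle_ge p a
  refine ⟨θ, hθ, ?_⟩
  rw [h] at hp
  have := (smul_uv_mem_frontier_iff hc hK h0 (norm_nonneg _) θ).1 hp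
  rw [polC, ← this, ← h]

lemma polC_inj (hc : IsCompact K) (h0 : K ∈ nhds 0)
    {a α β : ℝ} (hα : α ∈ Set.Ico a (a + 2 * π)) (hβ : β ∈ Set.Ico a (a + 2 * π))
    (h : polC K α = polC K β) : α = β := by
  apply uv_inj hα hβ
  have hn : ‖polC K α‖ = ‖polC K β‖ := by rw [h]
  simp only [polC, norm_smul, uv_norm, mul_one, norm_eq_abs, abs_of_pos (polR_pos hc h0 _)] at hn
  simp only [polC] at h
  rw [hn] at h
  exact smul_right_injective _ (polR_pos hc h0 β).ne' h

lemma polR_le (hc : IsCompact K) (h0 : K ∈ nhds 0) :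
    ∃ M > 0, ∀ θ, polR K θ ≤ M := by
  obtain ⟨M, hM⟩ := hc.isBounded.subset_closedBall (0 : EuclideanSpace ℝ (Fin 2))
  have hM' : K ⊆ closedBall 0 (max M 1) := hM.trans (closedBall_subset_closedBall (le_max_left _ _))
  have hpos : 0 < max M 1 := lt_max_of_lt_right one_pos
  refine ⟨max M 1, hpos, fun θ => ?_⟩
  have := le_gauge_of_subset_closedBall (absorbent_nhds_zero h0) hpos.le hM' (x := uv θ)
  rw [uv_norm] at this
  rw [polR]
  exact inv_le_of_inv_le₀ hpos (by simpa using this)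

lemma polR_lipschitz (hc : IsCompact K) (hK : Convex ℝ K) (h0 : K ∈ nhds 0) :
    ∃ C, LipschitzWith C (polR K) := by
  obtain ⟨D, hD⟩ := hK.lipschitz_gauge h0
  obtain ⟨M, hM, hMR⟩ := polR_le hc h0
  refine ⟨(M ^ 2).toNNReal * D, LipschitzWith.of_dist_le_mul fun a b => ?_⟩
  have h1 := (hD.comp uv_lipschitz).dist_le_mul a b
  simp only [Function.comp, mul_one] at h1
  have pa := gauge_uv_pos hc h0 a
  have pb := gauge_uv_pos hc h0 b
  have ea : polR K a - polR K b = (polR K a * polR K b) * (gauge K (uv b) - gauge K (uv a)) := by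
    simp only [polR]; field_simp
  rw [Real.dist_eq, ea, abs_mul, abs_sub_comm, ← Real.dist_eq]
  push_cast
  rw [Real.coe_toNNReal _ (by positivity)]
  have hra := polR_pos hc h0 a
  have hrb := polR_pos hc h0 b
  rw [abs_of_pos (mul_pos hra hrb), mul_assoc (M ^ 2)]
  apply mul_le_mul _ h1 dist_nonneg (by positivity)
  rw [sq]
  exact mul_le_mul (hMR a) (hMR b) hrb.le hM.le

lemma polC_lipschitz (hc : IsCompact K) (hK : Convex ℝ K) (h0 : K ∈ nhds 0) :
    ∃ C, LipschitzWith C (polC K) := by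
  obtain ⟨D, hD⟩ := polR_lipschitz hc hK h0
  obtain ⟨M, hM, hMR⟩ := polR_le hc h0
  refine ⟨D + M.toNNReal, LipschitzWith.of_dist_le_mul fun a b => ?_⟩
  have h1 := hD.dist_le_mul a b
  have h2 := uv_lipschitz.dist_le_mul a b
  have e : polC K a - polC K b = (polR K a - polR K b) • uv a + polR K b • (uv a - uv b) := by
    simp only [polC]; module
  rw [dist_eq_norm, e]
  refine (norm_add_le _ _).trans ?_
  rw [norm_smul, norm_smul, uv_norm, mul_one, ← dist_eq_norm, ← dist_eq_norm, NNReal.coe_add,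
    Real.coe_toNNReal _ hM.le, add_mul, norm_of_nonneg (polR_pos hc h0 b).le]
  simp only [NNReal.coe_one, one_mul] at h2
  apply add_le_add h1
  exact mul_le_mul (hMR b) h2 dist_nonneg hM.le

lemma coord_lipschitz {f : ℝ → EuclideanSpace ℝ (Fin 2)} {C : NNReal} (hf : LipschitzWith C f)
    (i : Fin 2) : LipschitzWith C (fun θ => f θ i) := by
  apply LipschitzWith.of_dist_le_mul
  intro a b
  refine le_trans ?_ (hf.dist_le_mul a b)
  rw [Real.dist_eq, dist_eq_norm]
  have := PiLp.norm_apply_le (f a - f b) i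
  simpa using this

lemma chord_le_hausdorff {f : ℝ → EuclideanSpace ℝ (Fin 2)} (hf : Continuous f) {a b : ℝ}
    (hab : a ≤ b) : ENNReal.ofReal ‖f b - f a‖ ≤ μH[1] (f '' Set.Ioo a b) := by
  rcases eq_or_ne (f b - f a) 0 with h | h
  · simp [h]
  set e : EuclideanSpace ℝ (Fin 2) := ‖f b - f a‖⁻¹ • (f b - f a) with he
  have hn : ‖f b - f a‖ ≠ 0 := norm_ne_zero_iff.2 h
  have hen : ‖e‖ = 1 := by
    rw [he, norm_smul, norm_inv, norm_norm, inv_mul_cancel₀ hn]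
  set p : EuclideanSpace ℝ (Fin 2) → ℝ := fun x => inner ℝ e x with hp
  have hpL : LipschitzWith 1 p := by
    apply LipschitzWith.of_dist_le_mul
    intro x y
    rw [Real.dist_eq, dist_eq_norm, NNReal.coe_one, one_mul, hp]
    simp only
    rw [← inner_sub_right]
    simpa [hen] using abs_real_inner_le_norm e (x - y)
  have h1 := hpL.hausdorffMeasure_image_le (d := 1) zero_le_one (f '' Set.Ioo a b)
  rw [hausdorffMeasure_real] at h1
  simp only [ENNReal.coe_one, ENNReal.one_rpow, one_mul] at h1
  refine le_trans ?_ h1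
  rw [← Set.image_comp]
  have h2 : Set.Ioo ((p ∘ f) a) ((p ∘ f) b) ⊆ (p ∘ f) '' Set.Ioo a b :=
    intermediate_value_Ioo hab (hpL.continuous.comp hf).continuousOn
  refine le_trans (le_of_eq ?_) (measure_mono h2)
  rw [Real.volume_Ioo]
  congr 1
  simp only [hp, Function.comp]
  rw [← inner_sub_right, he, real_inner_smul_left, real_inner_self_eq_norm_sq]
  field_simp

lemma hausdorff_arc_le {f : ℝ → EuclideanSpace ℝ (Fin 2)} {C : NNReal} (hf : LipschitzWith C f)
    {a b : ℝ} : μH[1] (f '' Set.Icc a b) ≤ ENNReal.ofReal (C * (b - a)) := by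
  have h1 := hf.hausdorffMeasure_image_le (d := 1) zero_le_one (Set.Icc a b)
  rw [hausdorffMeasure_real, Real.volume_Icc, ENNReal.rpow_one] at h1
  refine h1.trans (le_of_eq ?_)
  rw [ENNReal.ofReal_mul (by positivity), ENNReal.ofReal_coe_nnreal]

noncomputable def arcLen (K : Set (EuclideanSpace ℝ (Fin 2))) (a θ : ℝ) : ℝ :=
  (μH[1] (polC K '' Set.Icc a θ)).toReal

lemma arcLen_fin (hc : IsCompact K) (hK : Convex ℝ K) (h0 : K ∈ nhds 0) (a θ : ℝ) :
    μH[1] (polC K '' Set.Icc a θ) ≠ ⊤ := by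
  obtain ⟨C, hC⟩ := polC_lipschitz hc hK h0
  exact ne_top_of_le_ne_top ENNReal.ofReal_ne_top (hausdorff_arc_le hC)

lemma arcLen_chord (hc : IsCompact K) (hK : Convex ℝ K) (h0 : K ∈ nhds 0) {a α β : ℝ}
    (hα : a ≤ α) (hαβ : α ≤ β) (hβ : β ≤ a + 2 * π) :
    ‖polC K β - polC K α‖ ≤ arcLen K a β - arcLen K a α := by
  obtain ⟨C, hC⟩ := polC_lipschitz hc hK h0
  have h1 := chord_le_hausdorff hC.continuous hαβ
  rcases eq_or_lt_of_le hαβ with rfl | hlt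
  · simp
  have hdisj : Disjoint (polC K '' Set.Icc a α) (polC K '' Set.Ioo α β) := by
    rw [Set.disjoint_left]
    rintro _ ⟨s, hs, rfl⟩ ⟨s', hs', h⟩
    have := polC_inj hc h0 (a := a) ⟨by linarith [hs'.1], by linarith [hs'.2]⟩
      ⟨hs.1, by linarith [hs.2]⟩ h
    linarith [hs.2, hs'.1]
  have hmeas : MeasurableSet (polC K '' Set.Icc a α) :=
    (isCompact_Icc.image hC.continuous).measurableSet
  have hsub : polC K '' Set.Icc a α ∪ polC K '' Set.Ioo α β ⊆ polC K '' Set.Icc a β := by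
    rw [← Set.image_union]
    apply Set.image_mono
    rintro s (hs | hs)
    · exact ⟨hs.1, hs.2.trans hαβ⟩
    · exact ⟨hα.trans hs.1.le, hs.2.le⟩
  have h2 := measure_mono (μ := μH[1]) hsub
  rw [measure_union' hdisj hmeas] at h2
  have h3 := (add_le_add le_rfl h1).trans h2
  have h4 := ENNReal.toReal_mono (arcLen_fin hc hK h0 a β) h3
  rw [ENNReal.toReal_add (arcLen_fin hc hK h0 a α) ENNReal.ofReal_ne_top,
    ENNReal.toReal_ofReal (norm_nonneg _)] at h4
  unfold arcLen
  linarith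

lemma arcLen_lipschitz (hc : IsCompact K) (hK : Convex ℝ K) (h0 : K ∈ nhds 0) (a : ℝ) :
    ∃ C, LipschitzOnWith C (arcLen K a) (Set.Icc a (a + 2 * π)) := by
  obtain ⟨C, hC⟩ := polC_lipschitz hc hK h0
  refine ⟨C, LipschitzOnWith.of_le_add_mul C ?_⟩
  intro β hβ α hα
  rcases le_total β α with h | h
  · have := arcLen_chord hc hK h0 hβ.1 h hα.2
    have h2 := norm_nonneg (polC K α - polC K β)
    have : 0 ≤ C * dist β α := by positivity
    linarith
  · have hsub : polC K '' Set.Icc a β ⊆ polC K '' Set.Icc a α ∪ polC K '' Set.Icc α β := by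
      rw [← Set.image_union]
      apply Set.image_mono
      intro s hs
      rcases le_total s α with h' | h'
      · exact Or.inl ⟨hs.1, h'⟩
      · exact Or.inr ⟨h', hs.2⟩
    have h2 := (measure_mono (μ := μH[1]) hsub).trans (measure_union_le _ _)
    have h3 := h2.trans (add_le_add le_rfl (hausdorff_arc_le hC))
    have h4 := ENNReal.toReal_mono (ENNReal.add_ne_top.2 ⟨arcLen_fin hc hK h0 a α,
      ENNReal.ofReal_ne_top⟩) h3
    rw [ENNReal.toReal_add (arcLen_fin hc hK h0 a α) ENNReal.ofReal_ne_top,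
      ENNReal.toReal_ofReal (mul_nonneg C.coe_nonneg (sub_nonneg.2 h))] at h4
    rw [Real.dist_eq, abs_of_nonneg (by linarith)]
    exact h4

lemma arcLen_total (hc : IsCompact K) (hK : Convex ℝ K) (h0 : K ∈ nhds 0) (a : ℝ) :
    arcLen K a (a + 2 * π) = euclPerim K := by
  unfold arcLen euclPerim
  congr 2
  ext p
  constructor
  · rintro ⟨s, _, rfl⟩
    exact polC_mem_frontier hc hK h0 s
  · intro hp
    obtain ⟨θ, hθ, rfl⟩ := frontier_exists hc hK h0 hp a
    exact ⟨θ, Set.Ico_subset_Icc_self hθ, rfl⟩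

lemma area_le (hc : IsCompact K) (hK : Convex ℝ K) (h0 : K ∈ nhds 0) (a : ℝ) :
    euclArea K ≤ (1 / 2) * ∫ s in a..(a + 2 * π), polR K s ^ 2 := by
  obtain ⟨C, hC⟩ := polR_lipschitz hc hK h0
  have hcont := hC.continuous
  set e : ℝ × ℝ → EuclideanSpace ℝ (Fin 2) := fun p => !₂[p.1, p.2] with he
  have hmp : MeasurePreserving e volume volume := by
    have h1 := (PiLp.volume_preserving_toLp (Fin 2)).comp
      ((volume_preserving_finTwoArrow ℝ).symm)
    exact h1
  have hv : volume K = volume (e ⁻¹' K) :=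
    (hmp.measure_preimage hc.measurableSet.nullMeasurableSet).symm
  have hmeasK : MeasurableSet (e ⁻¹' K) := hmp.measurable hc.measurableSet
  set D : Set (ℝ × ℝ) := {p | p.1 ≤ polR K p.2} with hD
  have hDm : MeasurableSet D :=
    (isClosed_le continuous_fst (hcont.comp continuous_snd)).measurableSet
  have hvol : volume K = ∫⁻ θ in Set.Ioo (-π) π, ENNReal.ofReal ((1 / 2) * polR K θ ^ 2) := by
    rw [hv, ← lintegral_indicator_one hmeasK, ← lintegral_comp_polarCoord_symm]
    have hcongr : ∫⁻ p in polarCoord.target, ENNReal.ofReal p.1 •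
        (e ⁻¹' K).indicator (1 : ℝ × ℝ → ENNReal) (polarCoord.symm p) =
        ∫⁻ p in polarCoord.target, D.indicator (fun p => ENNReal.ofReal p.1) p := by
      apply setLIntegral_congr_fun polarCoord.open_target.measurableSet
      intro p hp
      have hp1 : 0 < p.1 := hp.1
      have hiff : polarCoord.symm p ∈ e ⁻¹' K ↔ p ∈ D := by
        rw [Set.mem_preimage]
        have : e (polarCoord.symm p) = p.1 • uv p.2 := by
          ext i; fin_cases i <;> simp [he, uv, polarCoord]
        rw [this, smul_uv_mem_iff hc hK h0 hp1.le]
        rfl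
      by_cases hpD : p ∈ D
      · simp only [Set.indicator_of_mem hpD, Set.indicator_of_mem (hiff.2 hpD)]
        simp
      · simp only [Set.indicator_of_notMem hpD,
          Set.indicator_of_notMem (fun h => hpD (hiff.1 h))]
        simp
    rw [hcongr]
    have htar : polarCoord.target = Set.Ioi (0 : ℝ) ×ˢ Set.Ioo (-π) π := rfl
    rw [htar, Measure.volume_eq_prod, ← Measure.prod_restrict, lintegral_prod_symm]
    · apply lintegral_congr
      intro θ
      have hr := polR_pos hc h0 θ
      have h1 : ∀ s : ℝ, D.indicator (fun p => ENNReal.ofReal p.1) (s, θ) =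
          (Set.Iic (polR K θ)).indicator (fun s => ENNReal.ofReal s) s := by
        intro s
        simp [Set.indicator, hD]
      simp only [h1]
      rw [lintegral_indicator measurableSet_Iic, Measure.restrict_restrict measurableSet_Iic,
        Set.inter_comm, Set.Ioi_inter_Iic, ← ofReal_integral_eq_lintegral_ofReal,
        ← intervalIntegral.integral_of_le hr.le, integral_id]
      · congr 1; ring
      · exact (continuous_id.integrableOn_Icc).mono_set Set.Ioc_subset_Icc_self
      · rw [Filter.EventuallyLE, ae_restrict_iff' measurableSet_Ioc]
        exact Filter.Eventually.of_forall fun s hs => hs.1.le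
    · exact (Measurable.indicator (by fun_prop) hDm).aemeasurable
  have hcont2 : Continuous fun θ => (1 / 2) * polR K θ ^ 2 := by fun_prop
  rw [euclArea, hvol, ← ofReal_integral_eq_lintegral_ofReal, ENNReal.toReal_ofReal,
    ← integral_Ioc_eq_integral_Ioo, ← intervalIntegral.integral_of_le (by linarith [pi_pos]),
    intervalIntegral.integral_const_mul]
  · have hper : Function.Periodic (fun s => polR K s ^ 2) (2 * π) := by
      intro s; simp only [polR_periodic]
    have := hper.intervalIntegral_add_eq (-π) a
    rw [show -π + 2 * π = π by ring] at this
    rw [this]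
  · exact integral_nonneg fun θ => by positivity
  · exact (hcont2.integrableOn_Icc).mono_set Set.Ioo_subset_Icc_self
  · exact Filter.Eventually.of_forall fun θ => by positivity

/-! ### Part 4: from contact points to the inequality `A + π t² ≤ t P` -/

lemma loop_geom (hc : IsCompact K) (hK : Convex ℝ K) (h0 : K ∈ nhds 0)
    (q : EuclideanSpace ℝ (Fin 2)) {t : ℝ} (ht : 0 < t) (θ φ : Fin 3 → ℝ)
    (hθ1 : θ 0 ≤ θ 1) (hθ2 : θ 1 ≤ θ 2) (hθ3 : θ 2 ≤ θ 0 + 2 * π)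
    (hφ1 : φ 0 ≤ φ 1) (hφ2 : φ 1 ≤ φ 2) (hφ3 : φ 2 ≤ φ 0 + 2 * π)
    (hφ1' : φ 1 ≤ φ 0 + π) (hφ2' : φ 2 ≤ φ 1 + π) (hφ3' : φ 0 + 2 * π ≤ φ 2 + π)
    (hstrip1 : ∀ s ∈ Set.Icc (θ 0) (θ 1), |(polC K s 0 - q 0) * sin ((φ 0 + φ 1) / 2)
      - (polC K s 1 - q 1) * cos ((φ 0 + φ 1) / 2)| ≤ t)
    (hstrip2 : ∀ s ∈ Set.Icc (θ 1) (θ 2), |(polC K s 0 - q 0) * sin ((φ 1 + φ 2) / 2)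
      - (polC K s 1 - q 1) * cos ((φ 1 + φ 2) / 2)| ≤ t)
    (hstrip3 : ∀ s ∈ Set.Icc (θ 2) (θ 0 + 2 * π),
      |(polC K s 0 - q 0) * sin ((φ 2 + (φ 0 + 2 * π)) / 2)
      - (polC K s 1 - q 1) * cos ((φ 2 + (φ 0 + 2 * π)) / 2)| ≤ t)
    (hcont : ∀ i, polC K (θ i) = q + t • uv (φ i)) :
    euclArea K + π * t ^ 2 ≤ t * euclPerim K := by
  obtain ⟨Cr, hCr⟩ := polR_lipschitz hc hK h0
  obtain ⟨C, hC⟩ := polC_lipschitz hc hK h0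
  obtain ⟨Cl, hCl⟩ := arcLen_lipschitz hc hK h0 (θ 0)
  have hC0 := coord_lipschitz hC 0
  have hC1 := coord_lipschitz hC 1
  simp only [polC_zero, polC_one] at hC0 hC1 hstrip1 hstrip2 hstrip3
  have main := loop_polar hCr hC0 hC1 polR_periodic θ φ ht hθ1 hθ2 hθ3 hφ1 hφ2 hφ3 hφ1' hφ2' hφ3'
    hCl ?_ hstrip1 hstrip2 hstrip3 ?_ ?_
  · rw [arcLen_total hc hK h0] at main
    have h1 := area_le hc hK h0 (θ 0)
    have h2 : 0 ≤ arcLen K (θ 0) (θ 0) := ENNReal.toReal_nonneg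
    nlinarith
  · intro α hα β hβ hαβ
    have := arcLen_chord hc hK h0 hα.1 hαβ hβ.2
    rw [eucl_norm] at this
    simpa only [PiLp.sub_apply, polC_zero, polC_one] using this
  · intro i
    rw [← polC_zero, hcont i]
    simp [uv]
  · intro i
    rw [← polC_one, hcont i]
    simp [uv]

lemma gap_lemma {Z : Set ℝ} (hZ : IsClosed Z) (h : ∀ x, ∃ z ∈ Set.Icc x (x + π), z ∈ Z) :
    ∃ z : Fin 3 → ℝ, (∀ i, z i ∈ Z) ∧ z 0 ≤ z 1 ∧ z 1 ≤ z 2 ∧ z 2 ≤ z 0 + 2 * π ∧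
      z 1 ≤ z 0 + π ∧ z 2 ≤ z 1 + π ∧ z 0 + 2 * π ≤ z 2 + π := by
  have pp := pi_pos
  have hmax : ∀ a ∈ Z, ∃ b ∈ Z, a ≤ b ∧ b ≤ a + π ∧ ∀ c ∈ Z, c ≤ a + π → c ≤ b := by
    intro a ha
    have hne : (Z ∩ Set.Icc a (a + π)).Nonempty := ⟨a, ha, le_rfl, by linarith⟩
    obtain ⟨b, hb, hb'⟩ := (isCompact_Icc.inter_left hZ).exists_isGreatest hne
    refine ⟨b, hb.1, hb.2.1, hb.2.2, fun c hc hca => ?_⟩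
    rcases le_total a c with h1 | h1
    · exact hb' ⟨hc, h1, hca⟩
    · exact h1.trans hb.2.1
  obtain ⟨a, -, ha⟩ := h 0
  obtain ⟨b, hb, hab, hba, hbm⟩ := hmax a ha
  obtain ⟨c, hc, hbc, hcb, hcm⟩ := hmax b hb
  refine ⟨![a, b, c], ?_, hab, hbc, ?_, hba, hcb, ?_⟩
  · intro i; fin_cases i <;> assumption
  · simp; linarith
  · simp only [Matrix.cons_val]
    by_contra hlt
    push Not at hlt
    have hcab : c ≤ b := hbm c hc (by linarith)
    -- no points of `Z` in `(b, b + π]`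
    have hbZ : b + π ∉ Z := fun h' => by have := hcm _ h' le_rfl; linarith
    obtain ⟨ε, hε, hball⟩ := Metric.isOpen_iff.1 hZ.isOpen_compl (b + π) hbZ
    obtain ⟨z, hz, hzZ⟩ := h (b + ε / 2)
    have h1 : ¬ z ≤ b + π := fun h' => by have := hcm z hzZ h'; linarith [hz.1]
    push Not at h1
    refine hball ?_ hzZ
    rw [Metric.mem_ball, Real.dist_eq, abs_of_pos (by linarith)]
    linarith [hz.2]

lemma centered (hc : IsCompact K) (hK : Convex ℝ K) (h0 : K ∈ nhds 0) {t : ℝ} (ht : 0 < t)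
    (hZ : ∀ x, ∃ z ∈ Set.Icc x (x + π), polR K z = t)
    (H : ∀ s z, polR K z = t → polR K s * cos (s - z) ≤ t) :
    euclArea K + π * t ^ 2 ≤ t * euclPerim K := by
  have pp := pi_pos
  obtain ⟨Cr, hCr⟩ := polR_lipschitz hc hK h0
  have hcl : IsClosed {z | polR K z = t} := isClosed_eq hCr.continuous continuous_const
  obtain ⟨z, hzZ, h1, h2, h3, h4, h5, h6⟩ := gap_lemma hcl hZ
  have strip : ∀ a b s, polR K a = t → polR K b = t → a ≤ s → s ≤ b → b ≤ a + π →
      |(polC K s 0 - (0 : EuclideanSpace ℝ (Fin 2)) 0) * sin ((a + b) / 2)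
      - (polC K s 1 - (0 : EuclideanSpace ℝ (Fin 2)) 1) * cos ((a + b) / 2)| ≤ t := by
    intro a b s ha hb has hsb hba
    have e : (polC K s 0 - (0 : EuclideanSpace ℝ (Fin 2)) 0) * sin ((a + b) / 2)
      - (polC K s 1 - (0 : EuclideanSpace ℝ (Fin 2)) 1) * cos ((a + b) / 2)
      = polR K s * sin ((a + b) / 2 - s) := by
      rw [polC_zero, polC_one, sin_sub]; simp; ring
    rw [e]
    have hr := polR_pos hc h0 s
    have A := H s a ha
    have B := H s b hb
    have e1 : sin ((a + b) / 2 - s) ≤ cos (s - a) := by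
      rw [← cos_pi_div_two_sub]
      apply cos_le_cos_of_nonneg_of_le_pi <;> linarith
    have e2 : - sin ((a + b) / 2 - s) ≤ cos (s - b) := by
      rw [← sin_neg, ← cos_pi_div_two_sub, ← cos_neg (s - b)]
      apply cos_le_cos_of_nonneg_of_le_pi <;> linarith
    rw [abs_le]
    constructor <;> nlinarith
  refine loop_geom hc hK h0 0 ht z z h1 h2 h3 h1 h2 h3 h4 h5 h6 ?_ ?_ ?_ ?_
  · intro s hs; exact strip _ _ s (hzZ 0) (hzZ 1) hs.1 hs.2 h4
  · intro s hs; exact strip _ _ s (hzZ 1) (hzZ 2) hs.1 hs.2 h5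
  · intro s hs
    exact strip _ _ s (hzZ 2) ((polR_periodic _).trans (hzZ 0)) hs.1 hs.2 h6
  · intro i
    have := hzZ i
    simp only [Set.mem_setOf_eq] at this
    simp [polC, this]

/-- Contact points of `K` with the circle of centre `q` and radius `t` are in balanced position. -/
def BalancedAt (K : Set (EuclideanSpace ℝ (Fin 2))) (q : EuclideanSpace ℝ (Fin 2)) (t : ℝ) : Prop :=
  ∀ w : EuclideanSpace ℝ (Fin 2), ∃ p ∈ frontier K, ‖p - q‖ = t ∧ 0 ≤ inner ℝ (p - q) w

lemma BalancedAt.angle {q : EuclideanSpace ℝ (Fin 2)} {t : ℝ} (ht : 0 < t)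
    (h : BalancedAt K q t) (x : ℝ) :
    ∃ z ∈ Set.Icc x (x + π), q + t • uv z ∈ frontier K := by
  have pp := pi_pos
  obtain ⟨p, hp, hpq, hin⟩ := h (uv (x + π / 2))
  obtain ⟨z, hz, hz'⟩ := exists_angle_ge (p - q) (x - π / 2)
  rw [hpq] at hz'
  refine ⟨z, ?_, by rw [← hz']; simpa using hp⟩
  rw [hz', real_inner_smul_left, eucl_inner, uv_zero, uv_zero, uv_one, uv_one, ← cos_sub] at hin
  have hcos : 0 ≤ cos (z - (x + π / 2)) := nonneg_of_mul_nonneg_right hin ht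
  constructor
  · by_contra hlt
    push Not at hlt
    have := cos_neg_of_pi_div_two_lt_of_lt (x := -(z - (x + π / 2))) (by linarith)
      (by linarith [hz.1])
    rw [cos_neg] at this
    linarith
  · by_contra hlt
    push Not at hlt
    have := cos_neg_of_pi_div_two_lt_of_lt (x := (z - (x + π / 2))) (by linarith)
      (by linarith [hz.2])
    linarith

lemma centered' (hc : IsCompact K) (hK : Convex ℝ K) (h0 : K ∈ nhds 0) {t : ℝ} (ht : 0 < t)
    (hb : BalancedAt K 0 t)
    (H : ∀ p ∈ frontier K, ‖p‖ = t → ∀ x ∈ K, inner ℝ x p ≤ t ^ 2) :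
    euclArea K + π * t ^ 2 ≤ t * euclPerim K := by
  refine centered hc hK h0 ht ?_ ?_
  · intro x
    obtain ⟨z, hz, hz'⟩ := hb.angle ht x
    rw [zero_add, smul_uv_mem_frontier_iff hc hK h0 ht.le] at hz'
    exact ⟨z, hz, hz'.symm⟩
  · intro s z hz
    have h1 := H (polC K z) (polC_mem_frontier hc hK h0 z)
      (by rw [polC, norm_smul, uv_norm, mul_one, norm_of_nonneg (polR_pos hc h0 z).le, hz])
      (polC K s) (hc.isClosed.frontier_subset (polC_mem_frontier hc hK h0 s))
    rw [eucl_inner, polC_zero, polC_zero, polC_one, polC_one, hz] at h1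
    rw [cos_sub]
    refine le_of_mul_le_mul_left ?_ ht
    linarith

lemma offcenter (hc : IsCompact K) (hK : Convex ℝ K) (h0 : K ∈ nhds 0) {t : ℝ} (ht : 0 < t)
    {q : EuclideanSpace ℝ (Fin 2)} (hq : q ∉ interior K) (hb : BalancedAt K q t)
    (hsub : K ⊆ closedBall q t) :
    euclArea K + π * t ^ 2 ≤ t * euclPerim K := by
  have pp := pi_pos
  have hne : (interior K).Nonempty := ⟨0, mem_interior_iff_mem_nhds.2 h0⟩
  obtain ⟨f, hf⟩ := geometric_hahn_banach_open_point hK.interior isOpen_interior hq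
  set v := (InnerProductSpace.toDual ℝ (EuclideanSpace ℝ (Fin 2))).symm f with hv
  have hfv : ∀ x, f x = inner ℝ v x := fun x => by
    rw [hv, InnerProductSpace.toDual_symm_apply]
  have hv0 : v ≠ 0 := by
    intro h
    have := hf 0 (mem_interior_iff_mem_nhds.2 h0)
    simp [hfv, h] at this
  have hfK : ∀ x ∈ K, inner ℝ v (x - q) ≤ 0 := by
    intro x hx
    have hx' : x ∈ closure (interior K) := by
      rw [hK.closure_interior_eq_closure_of_nonempty_interior hne]
      exact subset_closure hx
    have hcl : IsClosed {x | inner ℝ v (x - q) ≤ (0 : ℝ)} :=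
      isClosed_le (by fun_prop) continuous_const
    refine closure_minimal (fun y hy => ?_) hcl hx'
    have := hf y hy
    rw [hfv, hfv] at this
    simp only [Set.mem_setOf_eq, inner_sub_right]
    linarith
  obtain ⟨β, hβ⟩ := exists_angle v
  have hvn : 0 < ‖v‖ := norm_pos_iff.2 hv0
  set Z : Set ℝ := {z | q + t • uv z ∈ frontier K} with hZdef
  have hZ : IsClosed Z := isClosed_frontier.preimage
    (continuous_const.add (uv_lipschitz.continuous.const_smul t))
  have hex : ∀ z ∈ Z, cos (z - β) ≤ 0 := by
    intro z hz
    have h1 := hfK _ (hc.isClosed.frontier_subset hz)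
    rw [hβ, add_sub_cancel_left, real_inner_smul_left, real_inner_smul_right, eucl_inner,
      uv_zero, uv_zero, uv_one, uv_one] at h1
    rw [cos_sub]
    by_contra hlt
    push Not at hlt
    have : 0 < ‖v‖ * (t * (cos z * cos β + sin z * sin β)) := by positivity
    linarith
  set x := β - π / 2 with hx
  have hno : ∀ z ∈ Z, x < z → z < x + π → False := by
    intro z hz h1 h2
    have := hex z hz
    have := cos_pos_of_mem_Ioo (x := z - β) ⟨by linarith, by linarith⟩
    linarith
  have hxZ : x ∈ Z := by
    by_contra hn
    obtain ⟨ε, hε, hball⟩ := Metric.isOpen_iff.1 hZ.isOpen_compl x hn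
    obtain ⟨z, hz, hzZ⟩ := hb.angle ht (x - ε / 2)
    have hzx : z ≤ x := by
      by_contra h'
      push Not at h'
      exact hno z hzZ h' (by linarith [hz.2])
    refine hball ?_ hzZ
    rw [Metric.mem_ball, Real.dist_eq, abs_of_nonpos (by linarith)]
    linarith [hz.1]
  have hxZ' : x + π ∈ Z := by
    by_contra hn
    obtain ⟨ε, hε, hball⟩ := Metric.isOpen_iff.1 hZ.isOpen_compl (x + π) hn
    obtain ⟨z, hz, hzZ⟩ := hb.angle ht (x + ε / 2)
    have hzx : x + π ≤ z := by
      by_contra h'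
      push Not at h'
      exact hno z hzZ (by linarith [hz.1]) h'
    refine hball ?_ hzZ
    rw [Metric.mem_ball, Real.dist_eq, abs_of_nonneg (by linarith)]
    linarith [hz.2]
  obtain ⟨θ0, -, hθ0⟩ := frontier_exists hc hK h0 hxZ 0
  obtain ⟨θ1, hθ1, hθ1'⟩ := frontier_exists hc hK h0 hxZ' θ0
  have strip : ∀ s m : ℝ, |(polC K s 0 - q 0) * sin m - (polC K s 1 - q 1) * cos m| ≤ t := by
    intro s m
    have h1 := hsub (hc.isClosed.frontier_subset (polC_mem_frontier hc hK h0 s))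
    rw [mem_closedBall, dist_eq_norm] at h1
    have h2 : ‖polC K s - q‖ ^ 2 ≤ t ^ 2 := by gcongr
    rw [eucl_norm_sq] at h2
    simp only [PiLp.sub_apply] at h2
    apply abs_le_of_sq_le_sq _ ht.le
    refine le_trans ?_ h2
    have := sin_sq_add_cos_sq m
    have e : (polC K s 0 - q 0) ^ 2 + (polC K s 1 - q 1) ^ 2 =
      ((polC K s 0 - q 0) * sin m - (polC K s 1 - q 1) * cos m) ^ 2 +
      ((polC K s 0 - q 0) * cos m + (polC K s 1 - q 1) * sin m) ^ 2 := by
      linear_combination (-((polC K s 0 - q 0) ^ 2 + (polC K s 1 - q 1) ^ 2)) * this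
    rw [e]
    nlinarith [sq_nonneg ((polC K s 0 - q 0) * cos m + (polC K s 1 - q 1) * sin m)]
  refine loop_geom hc hK h0 q ht ![θ0, θ1, θ0 + 2 * π] ![x, x + π, x + 2 * π] hθ1.1 hθ1.2.le
    le_rfl ?_ ?_ le_rfl le_rfl ?_ ?_ (fun s _ => strip s _) (fun s _ => strip s _)
    (fun s _ => strip s _) ?_
  · simp; linarith
  · simp; linarith
  · simp; linarith
  · simp; linarith
  · intro i
    fin_cases i
    · exact hθ0.symm
    · exact hθ1'.symm
    · simp only [Fin.reduceFinMk, Matrix.cons_val]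
      rw [polC_periodic, uv_periodic]
      exact hθ0.symm

end geom

/-! ### Part 5: translation, existence of incircle and circumcircle, conclusion -/

section final
variable {K : Set (EuclideanSpace ℝ (Fin 2))}

theorem tr_frontier (o : EuclideanSpace ℝ (Fin 2)) :
    frontier ((fun x => o + x) ⁻¹' K) = (fun x => o + x) ⁻¹' frontier K :=
  ((Homeomorph.addLeft o).preimage_frontier K).symm

theorem tr_interior (o : EuclideanSpace ℝ (Fin 2)) :
    interior ((fun x => o + x) ⁻¹' K) = (fun x => o + x) ⁻¹' interior K :=
  ((Homeomorph.addLeft o).preimage_interior K).symm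

theorem tr_compact (hc : IsCompact K) (o : EuclideanSpace ℝ (Fin 2)) :
    IsCompact ((fun x => o + x) ⁻¹' K) :=
  (Homeomorph.addLeft o).isCompact_preimage.2 hc

theorem tr_nhds {o : EuclideanSpace ℝ (Fin 2)} (ho : o ∈ interior K) :
    (fun x => o + x) ⁻¹' K ∈ nhds 0 := by
  rw [mem_interior_iff_mem_nhds.symm, tr_interior]
  simpa using ho

theorem tr_area (o : EuclideanSpace ℝ (Fin 2)) :
    euclArea ((fun x => o + x) ⁻¹' K) = euclArea K := by
  unfold euclArea
  rw [measure_preimage_add]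

theorem tr_perim (o : EuclideanSpace ℝ (Fin 2)) :
    euclPerim ((fun x => o + x) ⁻¹' K) = euclPerim K := by
  unfold euclPerim
  rw [tr_frontier]
  congr 1
  exact (IsometryEquiv.addLeft o).hausdorffMeasure_preimage 1 (frontier K)

theorem tr_balanced {q : EuclideanSpace ℝ (Fin 2)} {t : ℝ} (hb : BalancedAt K q t)
    (o : EuclideanSpace ℝ (Fin 2)) : BalancedAt ((fun x => o + x) ⁻¹' K) (q - o) t := by
  intro w
  obtain ⟨p, hp, h1, h2⟩ := hb w
  refine ⟨p - o, ?_, ?_, ?_⟩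
  · rw [tr_frontier]; simpa using hp
  · rwa [sub_sub_sub_cancel_right]
  · rwa [sub_sub_sub_cancel_right]

theorem bonn_inner (hc : IsCompact K) (hK : Convex ℝ K) {q : EuclideanSpace ℝ (Fin 2)} {t : ℝ}
    (ht : 0 < t) (hb : BalancedAt K q t) (hsub : closedBall q t ⊆ K) :
    euclArea K + π * t ^ 2 ≤ t * euclPerim K := by
  have hqi : q ∈ interior K :=
    interior_mono hsub (ball_subset_interior_closedBall (mem_ball_self ht))
  have hb' := tr_balanced hb q
  rw [sub_self] at hb'
  have := centered' (tr_compact hc q) (hK.translate_preimage_right q) (tr_nhds hqi) ht hb' ?_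
  · rwa [tr_area, tr_perim] at this
  intro p hp hpt x hx
  rw [tr_frontier] at hp
  have hp' : q + p ∉ interior K := fun h => (disjoint_interior_frontier (s := K)).le_bot ⟨h, hp⟩
  obtain ⟨f, hf⟩ := geometric_hahn_banach_open_point hK.interior isOpen_interior hp'
  have hne : (interior K).Nonempty := ⟨q, hqi⟩
  have hle : ∀ y ∈ K, f y ≤ f (q + p) := by
    intro y hy
    have h1 : y ∈ closure (interior K) := by
      rw [hK.closure_interior_eq_closure_of_nonempty_interior hne]
      exact subset_closure hy
    exact le_on_closure (fun z hz => (hf z hz).le) f.continuous.continuousOn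
      continuousOn_const h1
  obtain ⟨v, rfl⟩ := (InnerProductSpace.toDual ℝ (EuclideanSpace ℝ (Fin 2))).surjective f
  simp only [InnerProductSpace.toDual_apply_apply] at hle hf
  have hv : v ≠ 0 := by
    rintro rfl
    simpa using hf q hqi
  have hvn : 0 < ‖v‖ := norm_pos_iff.2 hv
  have h1 := hle (q + (t / ‖v‖) • v) (hsub (by
    rw [mem_closedBall, dist_eq_norm, add_sub_cancel_left, norm_smul, Real.norm_eq_abs,
      abs_of_pos (by positivity), div_mul_cancel₀ _ hvn.ne']))
  simp only [inner_add_right, inner_smul_right, real_inner_self_eq_norm_sq] at h1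
  have h2 : t / ‖v‖ * ‖v‖ ^ 2 = t * ‖v‖ := by field_simp
  rw [h2] at h1
  have h3 : inner ℝ v p = ‖v‖ * ‖p‖ :=
    le_antisymm (real_inner_le_norm v p) (by rw [hpt]; linarith)
  have h4 := inner_eq_norm_mul_iff_real.1 h3
  rw [hpt] at h4
  have h5 := hle (q + x) hx
  simp only [inner_add_right] at h5
  have h6 : inner ℝ v x ≤ inner ℝ v p := by linarith
  have h7 : t * inner ℝ v x = ‖v‖ * inner ℝ p x := by
    rw [← real_inner_smul_left, ← real_inner_smul_left, h4]
  rw [h3, hpt] at h6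
  rw [real_inner_comm]
  have h8 : ‖v‖ * inner ℝ p x ≤ ‖v‖ * t ^ 2 := by rw [← h7]; nlinarith
  exact le_of_mul_le_mul_left h8 hvn

theorem bonn_outer (hc : IsCompact K) (hK : Convex ℝ K) (hne : (interior K).Nonempty)
    {q : EuclideanSpace ℝ (Fin 2)} {t : ℝ}
    (ht : 0 < t) (hb : BalancedAt K q t) (hsub : K ⊆ closedBall q t) :
    euclArea K + π * t ^ 2 ≤ t * euclPerim K := by
  by_cases hqi : q ∈ interior K
  · have hb' := tr_balanced hb q
    rw [sub_self] at hb'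
    have := centered' (tr_compact hc q) (hK.translate_preimage_right q) (tr_nhds hqi) ht hb' ?_
    · rwa [tr_area, tr_perim] at this
    intro p hp hpt x hx
    have h1 := hsub hx
    rw [mem_closedBall, dist_eq_norm, add_sub_cancel_left] at h1
    have h2 := real_inner_le_norm x p
    rw [hpt] at h2
    nlinarith
  · obtain ⟨o, ho⟩ := hne
    have := offcenter (tr_compact hc o) (hK.translate_preimage_right o) (tr_nhds ho) ht
      (q := q - o) ?_ (tr_balanced hb o) ?_
    · rwa [tr_area, tr_perim] at this
    · rw [tr_interior]; simpa using hqi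
    · intro x hx
      have h1 := hsub hx
      rw [mem_closedBall, dist_eq_norm] at h1 ⊢
      rwa [show x - (q - o) = o + x - q by abel]

theorem circum_exists (hc : IsCompact K) (hne : (interior K).Nonempty) :
    ∃ q, 0 < euclCircumradius K ∧ K ⊆ closedBall q (euclCircumradius K) := by
  set S := {R : ℝ | ∃ c, K ⊆ closedBall c R} with hS
  obtain ⟨z, hz⟩ := hne
  have hzK := interior_subset hz
  obtain ⟨ρ, hρ, hball⟩ := Metric.isOpen_iff.1 isOpen_interior z hz
  have hlow : ∀ R ∈ S, ρ / 4 ≤ R := by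
    rintro R ⟨c, hcR⟩
    have hy : z + (ρ / 2) • uv 0 ∈ K := interior_subset (hball (by
      rw [mem_ball, dist_eq_norm, add_sub_cancel_left, norm_smul, uv_norm, Real.norm_eq_abs,
        abs_of_pos (by positivity)]; linarith))
    have h1 := hcR hy
    have h2 := hcR hzK
    rw [mem_closedBall] at h1 h2
    have h3 := dist_triangle_right (z + (ρ / 2) • uv 0) z c
    have h4 : dist (z + (ρ / 2) • uv 0) z = ρ / 2 := by
      rw [dist_eq_norm, add_sub_cancel_left, norm_smul, uv_norm, Real.norm_eq_abs,
        abs_of_pos (by positivity)]; ring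
    linarith
  have hSne : S.Nonempty := by
    obtain ⟨R, hR⟩ := hc.isBounded.subset_closedBall 0
    exact ⟨R, 0, hR⟩
  have hbdd : BddBelow S := ⟨_, hlow⟩
  have hR : euclCircumradius K = sInf S := rfl
  rw [hR]
  have hpos : 0 < sInf S := lt_of_lt_of_le (by positivity) (le_csInf hSne hlow)
  have hex : ∀ n : ℕ, ∃ c, K ⊆ closedBall c (sInf S + 1 / ((n : ℝ) + 1)) := by
    intro n
    obtain ⟨R, ⟨c, hcR⟩, hlt⟩ := exists_lt_of_csInf_lt hSne
      (lt_add_of_pos_right (sInf S) (Nat.one_div_pos_of_nat (α := ℝ) (n := n)))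
    exact ⟨c, hcR.trans (closedBall_subset_closedBall hlt.le)⟩
  choose c hcn using hex
  have hcb : ∀ n, c n ∈ closedBall z (sInf S + 1) := by
    intro n
    have := hcn n hzK
    rw [mem_closedBall, dist_comm] at this
    rw [mem_closedBall]
    have h1 : 1 / ((n : ℝ) + 1) ≤ 1 := by
      rw [div_le_one (by positivity)]; linarith [(Nat.cast_nonneg n : (0:ℝ) ≤ n)]
    linarith
  obtain ⟨q, -, φ, hφ, hlim⟩ := (isCompact_closedBall z (sInf S + 1)).tendsto_subseq hcb
  refine ⟨q, hpos, fun x hx => ?_⟩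
  rw [mem_closedBall]
  have l1 : Filter.Tendsto (fun n => dist x (c (φ n))) Filter.atTop (nhds (dist x q)) :=
    tendsto_const_nhds.dist hlim
  have l2 : Filter.Tendsto (fun n => sInf S + 1 / ((φ n : ℝ) + 1)) Filter.atTop
      (nhds (sInf S + 0)) :=
    tendsto_const_nhds.add ((tendsto_one_div_add_atTop_nhds_zero_nat (𝕜 := ℝ)).comp
      hφ.tendsto_atTop)
  rw [add_zero] at l2
  exact le_of_tendsto_of_tendsto' l1 l2 (fun n => hcn _ hx)

theorem circum_balanced (hc : IsCompact K) (hne : (interior K).Nonempty)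
    {q : EuclideanSpace ℝ (Fin 2)} (hpos : 0 < euclCircumradius K)
    (hsub : K ⊆ closedBall q (euclCircumradius K)) : BalancedAt K q (euclCircumradius K) := by
  set R := euclCircumradius K with hR
  intro w
  have hKne : K.Nonempty := hne.mono interior_subset
  have hbdd : BddBelow {R : ℝ | ∃ c, K ⊆ closedBall c R} := by
    obtain ⟨z, hz⟩ := hKne
    refine ⟨0, ?_⟩
    rintro R ⟨c, hcR⟩
    exact dist_nonneg.trans (hcR hz)
  have hex : ∀ n : ℕ, ∃ p ∈ K, R ≤ dist p (q - (1 / ((n : ℝ) + 1)) • w) := by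
    intro n
    obtain ⟨p, hp, hmax⟩ := hc.exists_isMaxOn hKne
      (f := fun p => dist p (q - (1 / ((n : ℝ) + 1)) • w)) (by fun_prop)
    refine ⟨p, hp, ?_⟩
    exact csInf_le hbdd ⟨_, fun y hy => hmax hy⟩
  choose p hpK hp using hex
  obtain ⟨x, hxK, φ, hφ, hlim⟩ := hc.tendsto_subseq hpK
  have le0 : Filter.Tendsto (fun n => 1 / ((φ n : ℝ) + 1)) Filter.atTop (nhds 0) :=
    (tendsto_one_div_add_atTop_nhds_zero_nat (𝕜 := ℝ)).comp hφ.tendsto_atTop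
  have hxR : ‖x - q‖ ≤ R := by
    have := hsub hxK
    rwa [mem_closedBall, dist_eq_norm] at this
  have hxR' : R ≤ ‖x - q‖ := by
    have l1 : Filter.Tendsto (fun n => dist (p (φ n)) (q - (1 / ((φ n : ℝ) + 1)) • w))
        Filter.atTop (nhds (dist x (q - (0 : ℝ) • w))) :=
      hlim.dist (tendsto_const_nhds.sub (le0.smul_const w))
    rw [zero_smul, sub_zero, dist_eq_norm] at l1
    exact ge_of_tendsto' l1 (fun n => hp _)
  refine ⟨x, ?_, le_antisymm hxR hxR', ?_⟩
  · refine ⟨subset_closure hxK, fun hi => ?_⟩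
    have := interior_mono hsub hi
    rw [interior_closedBall _ hpos.ne', mem_ball, dist_eq_norm] at this
    linarith
  · have l1 : Filter.Tendsto (fun n => 2 * inner ℝ (p (φ n) - q) w +
        1 / ((φ n : ℝ) + 1) * ‖w‖ ^ 2) Filter.atTop
        (nhds (2 * inner ℝ (x - q) w + 0 * ‖w‖ ^ 2)) :=
      (((hlim.sub tendsto_const_nhds).inner tendsto_const_nhds).const_mul 2).add
        (le0.mul_const _)
    have h := ge_of_tendsto' l1 (b := 0) (fun n => ?_)
    · linarith
    set ε := 1 / ((φ n : ℝ) + 1) with hε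
    have hεp : 0 < ε := by positivity
    have h1 := hp (φ n)
    have h2 := hsub (hpK (φ n))
    rw [mem_closedBall, dist_eq_norm] at h2
    rw [dist_eq_norm, ← hε, show p (φ n) - (q - ε • w) = (p (φ n) - q) + ε • w by abel] at h1
    have h3 := norm_add_sq_real (p (φ n) - q) (ε • w)
    rw [inner_smul_right, norm_smul, Real.norm_eq_abs, abs_of_pos hεp] at h3
    have h4 : R ^ 2 ≤ ‖(p (φ n) - q) + ε • w‖ ^ 2 := by gcongr
    have h5 : ‖p (φ n) - q‖ ^ 2 ≤ R ^ 2 := by gcongr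
    have h6 : 0 ≤ ε * (2 * inner ℝ (p (φ n) - q) w + ε * ‖w‖ ^ 2) := by nlinarith
    exact nonneg_of_mul_nonneg_right h6 hεp

theorem inr_bdd (hc : IsCompact K) : BddAbove {r : ℝ | ∃ c, closedBall c r ⊆ K} := by
  obtain ⟨M, hM⟩ := hc.isBounded.subset_closedBall 0
  refine ⟨max M 0, ?_⟩
  rintro r ⟨c, hcr⟩
  by_contra hlt
  push Not at hlt
  have hr0 : 0 < r := lt_of_le_of_lt (le_max_right _ _) hlt
  have hrM : M < r := lt_of_le_of_lt (le_max_left _ _) hlt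
  have hm : ∀ s : ℝ, |s| = r → ‖c + s • uv 0‖ ≤ M := by
    intro s hs
    have h1 : c + s • uv 0 ∈ closedBall c r := by
      rw [mem_closedBall, dist_eq_norm, add_sub_cancel_left, norm_smul, uv_norm,
        Real.norm_eq_abs, hs, mul_one]
    have := hM (hcr h1)
    rwa [mem_closedBall, dist_zero_right] at this
  have h1 := hm r (abs_of_pos hr0)
  have h2 := hm (-r) (by rw [abs_neg, abs_of_pos hr0])
  have h3 := norm_sub_le (c + r • uv 0) (c + (-r) • uv 0)
  rw [show (c + r • uv 0) - (c + (-r) • uv 0) = (2 * r) • uv 0 by module, norm_smul, uv_norm,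
    Real.norm_eq_abs, abs_of_pos (by positivity)] at h3
  linarith

theorem inr_exists (hc : IsCompact K) (hne : (interior K).Nonempty) :
    ∃ q, 0 < euclInradius K ∧ closedBall q (euclInradius K) ⊆ K := by
  set S := {r : ℝ | ∃ c, closedBall c r ⊆ K} with hS
  have hR : euclInradius K = sSup S := rfl
  rw [hR]
  obtain ⟨z, hz⟩ := hne
  obtain ⟨ρ, hρ, hball⟩ := Metric.isOpen_iff.1 isOpen_interior z hz
  have hmem : ρ / 2 ∈ S :=
    ⟨z, (closedBall_subset_ball (by linarith)).trans (hball.trans interior_subset)⟩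
  have hbdd : BddAbove S := inr_bdd hc
  have hpos : 0 < sSup S := lt_of_lt_of_le (by positivity) (le_csSup hbdd hmem)
  obtain ⟨u, hu, hulim, huS⟩ := exists_seq_tendsto_sSup ⟨_, hmem⟩ hbdd
  choose c hcn using huS
  have hev : ∀ᶠ n in Filter.atTop, c n ∈ K := by
    filter_upwards [hulim.eventually (lt_mem_nhds hpos)] with n hn
    exact hcn n (mem_closedBall_self hn.le)
  obtain ⟨q, -, φ, hφ, hlim⟩ := hc.tendsto_subseq' hev.frequently
  refine ⟨q, hpos, ?_⟩
  have hulim' := hulim.comp hφ.tendsto_atTop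
  have hbsub : ball q (sSup S) ⊆ K := by
    intro x hx
    rw [mem_ball] at hx
    have l : Filter.Tendsto (fun n => u (φ n) - dist x (c (φ n))) Filter.atTop
      (nhds (sSup S - dist x q)) := hulim'.sub (tendsto_const_nhds.dist hlim)
    obtain ⟨n, hn⟩ := (l.eventually (lt_mem_nhds (sub_pos.2 hx))).exists
    exact hcn (φ n) (by rw [mem_closedBall]; linarith)
  rw [← closure_ball q hpos.ne']
  exact closure_minimal hbsub hc.isClosed

theorem inr_balanced (hc : IsCompact K) {q : EuclideanSpace ℝ (Fin 2)}
    (hpos : 0 < euclInradius K)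
    (hsub : closedBall q (euclInradius K) ⊆ K) : BalancedAt K q (euclInradius K) := by
  set r := euclInradius K with hr
  intro w
  have hex : ∀ n : ℕ, ∃ x, x ∉ K ∧ dist x (q + (1 / ((n : ℝ) + 1)) • w) ≤
      r + (1 / ((n : ℝ) + 1)) ^ 2 := by
    intro n
    by_contra! hcon
    have hm : r + (1 / ((n : ℝ) + 1)) ^ 2 ≤ r := by
      refine le_csSup (inr_bdd hc) ⟨q + (1 / ((n : ℝ) + 1)) • w, fun x hx => ?_⟩
      by_contra hxK
      exact absurd (hcon x hxK) (not_lt.2 hx)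
    have : 0 < (1 / ((n : ℝ) + 1)) ^ 2 := by positivity
    linarith
  choose p hpK hp using hex
  have hle1 : ∀ n : ℕ, 1 / ((n : ℝ) + 1) ≤ 1 := by
    intro n
    rw [div_le_one (by positivity)]; linarith [(Nat.cast_nonneg n : (0:ℝ) ≤ n)]
  have hpb : ∀ n, p n ∈ closedBall q (r + 1 + ‖w‖) := by
    intro n
    have h0 : 0 < 1 / ((n : ℝ) + 1) := by positivity
    have h1 := dist_triangle (p n) (q + (1 / ((n : ℝ) + 1)) • w) q
    rw [dist_eq_norm (q + (1 / ((n : ℝ) + 1)) • w) q, add_sub_cancel_left, norm_smul,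
      Real.norm_eq_abs, abs_of_pos h0] at h1
    have h2 := hp n
    have h3 := hle1 n
    rw [mem_closedBall]
    nlinarith [norm_nonneg w]
  obtain ⟨x, -, φ, hφ, hlim⟩ := (isCompact_closedBall q _).tendsto_subseq hpb
  have le0 : Filter.Tendsto (fun n => 1 / ((φ n : ℝ) + 1)) Filter.atTop (nhds 0) :=
    (tendsto_one_div_add_atTop_nhds_zero_nat (𝕜 := ℝ)).comp hφ.tendsto_atTop
  have hfar : ∀ n, r < ‖p n - q‖ := by
    intro n
    by_contra h
    push Not at h
    exact hpK n (hsub (by rwa [mem_closedBall, dist_eq_norm]))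
  have hxR : ‖x - q‖ ≤ r := by
    have l1 : Filter.Tendsto (fun n => dist (p (φ n)) (q + (1 / ((φ n : ℝ) + 1)) • w))
        Filter.atTop (nhds (dist x (q + (0 : ℝ) • w))) :=
      hlim.dist (tendsto_const_nhds.add (le0.smul_const w))
    have l2 : Filter.Tendsto (fun n => r + (1 / ((φ n : ℝ) + 1)) ^ 2)
        Filter.atTop (nhds (r + 0 ^ 2)) := tendsto_const_nhds.add (le0.pow 2)
    have := le_of_tendsto_of_tendsto' l1 l2 (fun n => hp _)
    rw [zero_smul, add_zero, dist_eq_norm] at this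
    linarith
  have hxR' : r ≤ ‖x - q‖ :=
    ge_of_tendsto' ((hlim.sub tendsto_const_nhds).norm) (fun n => (hfar _).le)
  have hxK : x ∈ K := hsub (by rwa [mem_closedBall, dist_eq_norm])
  refine ⟨x, ⟨subset_closure hxK, fun hi => ?_⟩, le_antisymm hxR hxR', ?_⟩
  · obtain ⟨n, hn⟩ := (hlim.eventually (isOpen_interior.mem_nhds hi)).exists
    exact hpK _ (interior_subset hn)
  · have l1 : Filter.Tendsto (fun n => 2 * inner ℝ (p (φ n) - q) w +
        1 / ((φ n : ℝ) + 1) * (2 * r + 1)) Filter.atTop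
        (nhds (2 * inner ℝ (x - q) w + 0 * (2 * r + 1))) :=
      (((hlim.sub tendsto_const_nhds).inner tendsto_const_nhds).const_mul 2).add
        (le0.mul_const _)
    have h := ge_of_tendsto' l1 (b := 0) (fun n => ?_)
    · linarith
    have hε1 := hle1 (φ n)
    have h1 := hp (φ n)
    have h2 := hfar (φ n)
    have hεp : 0 < 1 / ((φ n : ℝ) + 1) := by positivity
    generalize 1 / ((φ n : ℝ) + 1) = ε at *
    rw [dist_eq_norm, show p (φ n) - (q + ε • w) = (p (φ n) - q) - ε • w by abel] at h1
    have h3 := norm_sub_sq_real (p (φ n) - q) (ε • w)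
    rw [inner_smul_right, norm_smul, Real.norm_eq_abs, abs_of_pos hεp] at h3
    have h4 : ‖(p (φ n) - q) - ε • w‖ ^ 2 ≤ (r + ε ^ 2) ^ 2 := by gcongr
    have h5 : r ^ 2 ≤ ‖p (φ n) - q‖ ^ 2 := by gcongr
    have h7 : ε ^ 4 ≤ ε ^ 2 := pow_le_pow_of_le_one hεp.le hε1 (by norm_num)
    have h6 : 0 ≤ ε * (2 * inner ℝ (p (φ n) - q) w + ε * (2 * r + 1)) := by
      nlinarith [sq_nonneg (ε * ‖w‖)]
    exact nonneg_of_mul_nonneg_right h6 hεp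

end final

/-- Bonnesen-type inequality in the Euclidean plane:
`P_K² − 4π·A_K ≥ π²·(R_K − r_K)²`. -/
theorem bonnesen_inequality_euclidean (K : Set (EuclideanSpace ℝ (Fin 2)))
    (hKcomp : IsCompact K) (hKconv : Convex ℝ K) (hKint : (interior K).Nonempty) :
    euclPerim K ^ 2 - 4 * π * euclArea K ≥
      π ^ 2 * (euclCircumradius K - euclInradius K) ^ 2 := by
  obtain ⟨c, hR, hcR⟩ := circum_exists hKcomp hKint
  obtain ⟨i, hr, hir⟩ := inr_exists hKcomp hKint
  have h1 := bonn_outer hKcomp hKconv hKint hR (circum_balanced hKcomp hKint hR hcR) hcR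
  have h2 := bonn_inner hKcomp hKconv hr (inr_balanced hKcomp hr hir) hir
  generalize euclPerim K = P at *
  generalize euclArea K = A at *
  generalize euclCircumradius K = R at *
  generalize euclInradius K = r at *
  have h3 := mul_le_mul_of_nonneg_left h1 pi_pos.le
  have h4 := mul_le_mul_of_nonneg_left h2 pi_pos.le
  nlinarith [sq_nonneg (2 * π * r - P + (2 * π * R - P))]
end

section
/- Let K be a compact convex set in ℝ² with nonempty interior. Then P_K² − 4π·A_K ≥ 0, with equality if and only if K is a closed Euclidean disc (a closed ball of some positive radius). -/
open MeasureTheory Metric Real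

open Set Filter Topology in
lemma iso_wirtinger_aux {x s w : ℝ → ℝ} {Cx Cs : NNReal} (hx : LipschitzWith Cx x)
    (hs : LipschitzWith Cs s) (hmono : Monotone s) {a b l : ℝ} (hab : a ≤ b) (hl : 0 < l)
    (hsl : s b = s a + l) (hxa : x a = 0) (hxb : x b = 0)
    (hwi : IntervalIntegrable w volume a b)
    (hw : ∀ᵐ t, deriv x t ^ 2 ≤ w t * deriv s t) (hs' : ∀ᵐ t, 0 < deriv s t)
    {k : ℝ} (hk0 : 0 < k) (hk : k < π / l) :
    k ^ 2 * ∫ t in a..b, x t ^ 2 * deriv s t ≤ ∫ t in a..b, w t := by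
  have hkl : k * l < π := by rwa [lt_div_iff₀ hl] at hk
  set m := s a + l / 2 with hm
  have hrange : ∀ u ∈ Icc (s a) (s b), k * (u - m) ∈ Ioo (-(π / 2)) (π / 2) := by
    rintro u ⟨h1, h2⟩
    constructor <;> nlinarith
  have hcos : ∀ u ∈ Icc (s a) (s b), cos (k * (u - m)) ≠ 0 := fun u hu =>
    (cos_pos_of_mem_Ioo (hrange u hu)).ne'
  have hmaps : ∀ t ∈ Icc a b, s t ∈ Icc (s a) (s b) := fun t ht => ⟨hmono ht.1, hmono ht.2⟩
  have hTc : ContDiffOn ℝ 1 (fun u => tan (k * (u - m))) (Icc (s a) (s b)) := by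
    intro u hu
    apply ContDiffAt.contDiffWithinAt
    exact ContDiffAt.comp (g := tan) u (contDiffAt_tan.2 (hcos u hu)) (by fun_prop)
  obtain ⟨K, hK⟩ := hTc.exists_lipschitzOnWith (by decide) (convex_Icc _ _) isCompact_Icc
  have hxac : AbsolutelyContinuousOnInterval x a b :=
    (hx.lipschitzOnWith (s := uIcc a b)).absolutelyContinuousOnInterval
  have hsac : AbsolutelyContinuousOnInterval s a b :=
    (hs.lipschitzOnWith (s := uIcc a b)).absolutelyContinuousOnInterval
  have hTac : AbsolutelyContinuousOnInterval (fun t => tan (k * (s t - m))) a b := by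
    have := hK.comp (hs.lipschitzOnWith (s := uIcc a b)) (by rw [uIcc_of_le hab]; exact hmaps)
    exact this.absolutelyContinuousOnInterval
  have hφ := (hxac.fun_mul hxac).fun_mul hTac
  have hF := hφ.integral_deriv_eq_sub
  simp only [hxa, hxb, mul_zero, zero_mul, sub_zero] at hF
  have hi1 : IntervalIntegrable (fun t => x t ^ 2 * deriv s t) volume a b :=
    hsac.intervalIntegrable_deriv.continuousOn_mul (hx.continuous.pow 2).continuousOn
  have key : ∫ t in a..b, (k ^ 2 * (x t ^ 2 * deriv s t) - 
      k * deriv (fun t => x t * x t * tan (k * (s t - m))) t) ≤ ∫ t in a..b, w t := by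
    apply intervalIntegral.integral_mono_ae_restrict hab
      ((hi1.const_mul _).sub (hφ.intervalIntegrable_deriv.const_mul _)) hwi
    rw [EventuallyLE, ae_restrict_iff' measurableSet_Icc]
    filter_upwards [hx.ae_differentiableAt_real, hs.ae_differentiableAt_real, hw, hs']
      with t h1 h2 h3 h4 ht
    have hc := hcos _ (hmaps t ht)
    have hd : HasDerivAt (fun t => x t * x t * tan (k * (s t - m)))
        ((deriv x t * x t + x t * deriv x t) * tan (k * (s t - m)) +
          x t * x t * (1 / cos (k * (s t - m)) ^ 2 * (k * deriv s t))) t :=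
      (h1.hasDerivAt.mul h1.hasDerivAt).mul
        (HasDerivAt.comp (h₂ := tan) t (hasDerivAt_tan hc) ((h2.hasDerivAt.sub_const m).const_mul k))
    rw [hd.deriv]
    set T := tan (k * (s t - m)) with hT
    have hsec : 1 / cos (k * (s t - m)) ^ 2 = 1 + T ^ 2 := by
      rw [hT, ← inv_one_add_tan_sq hc]; simp
    rw [hsec]
    set y := x t
    set y' := deriv x t
    set σ := deriv s t
    have : 0 ≤ σ * (w t - (k ^ 2 * (y ^ 2 * σ) - k * ((y' * y + y * y') * T + 
        y * y * ((1 + T ^ 2) * (k * σ))))) := by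
      nlinarith [sq_nonneg (y' + k * y * T * σ)]
    have := nonneg_of_mul_nonneg_right this h4
    linarith
  rw [intervalIntegral.integral_sub (hi1.const_mul _) (hφ.intervalIntegrable_deriv.const_mul _),
    intervalIntegral.integral_const_mul, intervalIntegral.integral_const_mul, hF] at key
  linarith

open Set Filter Topology in
lemma iso_wirtinger {x s w : ℝ → ℝ} {Cx Cs : NNReal} (hx : LipschitzWith Cx x)
    (hs : LipschitzWith Cs s) (hmono : Monotone s) {a b l : ℝ} (hab : a ≤ b) (hl : 0 < l)
    (hsl : s b = s a + l) (hxab : x a = x b)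
    (hwi : IntervalIntegrable w volume a b)
    (hw : ∀ᵐ t, deriv x t ^ 2 ≤ w t * deriv s t) (hs' : ∀ᵐ t, 0 < deriv s t) :
    (π / l) ^ 2 * ∫ t in a..b, (x t - x a) ^ 2 * deriv s t ≤ ∫ t in a..b, w t := by
  have h : ∀ k ∈ Ioo 0 (π / l), k ^ 2 * ∫ t in a..b, (x t - x a) ^ 2 * deriv s t ≤
      ∫ t in a..b, w t := by
    intro k hk
    refine iso_wirtinger_aux (x := fun t => x t - x a) (Cx := Cx) ?_ hs hmono hab hl hsl (by simp)
      (by simp [hxab]) hwi ?_ hs' hk.1 hk.2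
    · exact LipschitzWith.of_dist_le_mul fun p q => by simpa using hx.dist_le_mul p q
    · filter_upwards [hw] with t ht
      simpa using ht
  have ht : Tendsto (fun k : ℝ => k ^ 2 * ∫ t in a..b, (x t - x a) ^ 2 * deriv s t) (𝓝[<] (π / l))
      (𝓝 ((π / l) ^ 2 * ∫ t in a..b, (x t - x a) ^ 2 * deriv s t)) := by
    apply Tendsto.mono_left _ nhdsWithin_le_nhds
    exact (Continuous.tendsto (by fun_prop) _)
  refine le_of_tendsto ht ?_
  filter_upwards [Ioo_mem_nhdsLT (show (0:ℝ) < π / l by positivity)] with k hk using h k hk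

lemma iso_lip_int {f : ℝ → ℝ} {C : NNReal} (hf : LipschitzWith C f) (a b : ℝ) :
    IntervalIntegrable (deriv f) volume a b ∧ ∫ t in a..b, deriv f t = f b - f a := by
  have := (hf.lipschitzOnWith (s := Set.uIcc a b)).absolutelyContinuousOnInterval
  exact ⟨this.intervalIntegrable_deriv, this.integral_deriv_eq_sub⟩

lemma iso_growth {s : ℝ → ℝ} {C : NNReal} (hs : LipschitzWith C s) {c : ℝ}
    (hc : ∀ᵐ t, c ≤ deriv s t) {a b : ℝ} (hab : a ≤ b) : c * (b - a) ≤ s b - s a := by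
  rw [← (iso_lip_int hs a b).2]
  have : ∫ t in a..b, c = c * (b - a) := by simp [mul_comm]
  rw [← this]
  exact intervalIntegral.integral_mono_ae hab (by simp) (iso_lip_int hs a b).1 hc

open Set Filter Topology in
lemma iso_half {x s : ℝ → ℝ} {Cx Cs : NNReal} (hx : LipschitzWith Cx x)
    (hs : LipschitzWith Cs s) {T L c : ℝ} (hT : 0 < T) (hc0 : 0 < c)
    (hc : ∀ᵐ t, c ≤ deriv s t) (hxT : ∀ t, x (t + T) = x t) (hsT : ∀ t, s (t + T) = s t + L)
    (hxs : ∀ᵐ t, deriv x t ^ 2 ≤ deriv s t ^ 2) :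
    ∃ p : ℝ, IntervalIntegrable (fun t => deriv x t ^ 2 / deriv s t) volume 0 T ∧
      ∫ t in (0:ℝ)..T, (x t - p) ^ 2 * deriv s t ≤
        (L / (2 * π)) ^ 2 * ∫ t in (0:ℝ)..T, deriv x t ^ 2 / deriv s t := by
  have hgrow : ∀ {a b : ℝ}, a ≤ b → c * (b - a) ≤ s b - s a := fun h => iso_growth hs hc h
  have hsm : StrictMono s := fun a b hab => by
    have := hgrow hab.le
    nlinarith
  have hL : 0 < L := by
    have := hsT 0
    have h2 := hsm (show (0:ℝ) < 0 + T by linarith)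
    linarith
  have hsurj : Function.Surjective s := by
    refine hs.continuous.surjective ?_ ?_
    · refine tendsto_atTop_mono' _ (f₁ := fun t => c * t + s 0) ?_ ?_
      · filter_upwards [eventually_ge_atTop 0] with t ht
        have := hgrow ht
        linarith
      · exact tendsto_atTop_add_const_right _ _ (tendsto_id.const_mul_atTop hc0)
    · refine tendsto_atBot_mono' _ (f₁ := fun t => c * t + s 0) ?_ ?_
      · filter_upwards [eventually_le_atBot 0] with t ht
        have := hgrow ht
        linarith
      · exact tendsto_atBot_add_const_right _ _ (tendsto_id.const_mul_atBot hc0)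
  let e := (hsm.orderIsoOfSurjective s hsurj).toHomeomorph
  have hse : ∀ u, s (e.symm u) = u := fun u => e.apply_symm_apply u
  let h : ℝ → ℝ := fun t => e.symm (s t + L / 2)
  have hhc : Continuous h := e.symm.continuous.comp (hs.continuous.add continuous_const)
  have hsh : ∀ t, s (h t) = s t + L / 2 := fun t => hse _
  have hhh : ∀ t, h (h t) = t + T := fun t => hsm.injective (by rw [hsh, hsh, hsT]; ring)
  have hgt : ∀ t, t < h t := fun t => hsm.lt_iff_lt.1 (by rw [hsh]; linarith)
  -- find a point where `x` agrees at half length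
  obtain ⟨a, ha⟩ : ∃ a, x (h a) - x a = 0 := by
    have hcont : Continuous (fun t => x (h t) - x t) :=
      (hx.continuous.comp hhc).sub hx.continuous
    have h1 : x (h (h 0)) - x (h 0) = -(x (h 0) - x 0) := by
      rw [hhh, hxT]; ring
    rcases le_total (x (h 0) - x 0) 0 with h0 | h0
    · exact mem_range_of_exists_le_of_exists_ge hcont ⟨0, h0⟩ ⟨h 0, by linarith⟩
    · exact mem_range_of_exists_le_of_exists_ge hcont ⟨h 0, by linarith⟩ ⟨0, h0⟩
  have hwi : ∀ a b, IntervalIntegrable (fun t => deriv x t ^ 2 / deriv s t) volume a b := by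
    intro a b
    refine (iso_lip_int hs a b).1.mono_fun ?_ ?_
    · exact (((measurable_deriv x).pow_const 2).div (measurable_deriv s)).aestronglyMeasurable
    · apply ae_restrict_of_ae
      filter_upwards [hc, hxs] with t h1 h2
      have h3 : 0 < deriv s t := hc0.trans_le h1
      rw [norm_of_nonneg (by positivity), norm_of_nonneg h3.le, div_le_iff₀ h3]
      linarith
  have hw : ∀ᵐ t, deriv x t ^ 2 ≤ (deriv x t ^ 2 / deriv s t) * deriv s t := by
    filter_upwards [hc] with t h1
    rw [div_mul_cancel₀ _ (hc0.trans_le h1).ne']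
  have hs' : ∀ᵐ t, 0 < deriv s t := by
    filter_upwards [hc] with t h1 using hc0.trans_le h1
  have w1 := iso_wirtinger hx hs hsm.monotone (hgt a).le (half_pos hL) (hsh a) (by linarith)
    (hwi _ _) hw hs'
  have w2 := iso_wirtinger hx hs hsm.monotone (hgt (h a)).le (half_pos hL) (hsh (h a))
    (by rw [hhh, hxT]; linarith) (hwi _ _) hw hs'
  have hxa : x (h a) = x a := by linarith
  rw [hxa, hhh] at w2
  have hi1 : ∀ p q, IntervalIntegrable (fun t => (x t - x a) ^ 2 * deriv s t) volume p q := 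
    fun p q => (iso_lip_int hs p q).1.continuousOn_mul
      ((hx.continuous.sub continuous_const).pow 2).continuousOn
  have hadd := add_le_add w1 w2
  rw [← mul_add, intervalIntegral.integral_add_adjacent_intervals (hi1 _ _) (hi1 _ _),
    intervalIntegral.integral_add_adjacent_intervals (hwi _ _) (hwi _ _)] at hadd
  have hdx : ∀ t, deriv x (t + T) = deriv x t := fun t => by
    rw [← deriv_comp_add_const]; simp only [hxT]
  have hds : ∀ t, deriv s (t + T) = deriv s t := fun t => by
    rw [← deriv_comp_add_const]; simp only [hsT, deriv_add_const]
  have p1 : Function.Periodic (fun t => (x t - x a) ^ 2 * deriv s t) T := fun t => by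
    simp only [hxT, hds]
  have p2 : Function.Periodic (fun t => deriv x t ^ 2 / deriv s t) T := fun t => by
    simp only [hdx, hds]
  rw [p1.intervalIntegral_add_eq a 0, p2.intervalIntegral_add_eq a 0, zero_add] at hadd
  refine ⟨x a, hwi _ _, ?_⟩
  have e1 : (π / (L / 2)) ^ 2 = ((L / (2 * π)) ^ 2)⁻¹ := by
    field_simp
  rw [e1, inv_mul_le_iff₀ (by positivity)] at hadd
  exact hadd

set_option maxHeartbeats 1000000 in
open Set Filter Topology in
lemma iso_analytic {x y s : ℝ → ℝ} {Cx Cy Cs : NNReal} (hx : LipschitzWith Cx x)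
    (hy : LipschitzWith Cy y)
    (hs : LipschitzWith Cs s) {T L c : ℝ} (hT : 0 < T) (hc0 : 0 < c)
    (hc : ∀ᵐ t, c ≤ deriv s t) (hxT : ∀ t, x (t + T) = x t) (hyT : ∀ t, y (t + T) = y t)
    (hsT : ∀ t, s (t + T) = s t + L)
    (hxys : ∀ᵐ t, deriv x t ^ 2 + deriv y t ^ 2 ≤ deriv s t ^ 2) :
    ∫ t in (0:ℝ)..T, (x t * deriv y t - y t * deriv x t) ≤ L ^ 2 / (2 * π) ∧
    (∫ t in (0:ℝ)..T, (x t * deriv y t - y t * deriv x t) = L ^ 2 / (2 * π) →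
      ∃ p q : ℝ, ∀ t, (x t - p) ^ 2 + (y t - q) ^ 2 = (L / (2 * π)) ^ 2) := by
  obtain ⟨p, hpi, hp⟩ := iso_half hx hs hT hc0 hc hxT hsT
    (by filter_upwards [hxys] with t ht using by nlinarith [sq_nonneg (deriv y t)])
  obtain ⟨q, hqi, hq⟩ := iso_half hy hs hT hc0 hc hyT hsT
    (by filter_upwards [hxys] with t ht using by nlinarith [sq_nonneg (deriv x t)])
  have hL : 0 < L := by
    have := iso_growth hs hc hT.le
    have h2 := hsT 0
    rw [zero_add] at h2
    nlinarith
  set r := L / (2 * π) with hr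
  have hr0 : 0 < r := by positivity
  obtain ⟨hsi, hsI⟩ := iso_lip_int hs 0 T
  obtain ⟨hxi, hxI⟩ := iso_lip_int hx 0 T
  obtain ⟨hyi, hyI⟩ := iso_lip_int hy 0 T
  have hsI' : ∫ t in (0:ℝ)..T, deriv s t = L := by
    have h2 := hsT 0
    rw [zero_add] at h2
    rw [hsI, h2]; ring
  have hxI' : ∫ t in (0:ℝ)..T, deriv x t = 0 := by
    have h2 := hxT 0
    rw [zero_add] at h2
    rw [hxI, h2]; ring
  have hyI' : ∫ t in (0:ℝ)..T, deriv y t = 0 := by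
    have h2 := hyT 0
    rw [zero_add] at h2
    rw [hyI, h2]; ring
  have hxc := hx.continuous
  have hyc := hy.continuous
  have hmul : ∀ {f g : ℝ → ℝ}, IntervalIntegrable g volume 0 T → Continuous f →
      IntervalIntegrable (fun t => f t * g t) volume 0 T :=
    fun hg hf => hg.continuousOn_mul hf.continuousOn
  have hsum : ∫ t in (0:ℝ)..T, (deriv x t ^ 2 / deriv s t + deriv y t ^ 2 / deriv s t) ≤ L := by
    rw [← hsI']
    apply intervalIntegral.integral_mono_ae hT.le (hpi.add hqi) hsi
    filter_upwards [hc, hxys] with t h1 h2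
    have h3 : 0 < deriv s t := hc0.trans_le h1
    change _ + _ ≤ _
    rw [← add_div, div_le_iff₀ h3]
    linarith
  rw [intervalIntegral.integral_add hpi hqi] at hsum
  let D : ℝ → ℝ := fun t => √((x t - p) ^ 2 + (y t - q) ^ 2)
  have hDc : Continuous D := by fun_prop
  have hD2 : ∀ t, D t ^ 2 = (x t - p) ^ 2 + (y t - q) ^ 2 := fun t => sq_sqrt (by positivity)
  have hDint : ∫ t in (0:ℝ)..T, D t ^ 2 * deriv s t ≤ r ^ 2 * L := by
    have : ∫ t in (0:ℝ)..T, D t ^ 2 * deriv s t = (∫ t in (0:ℝ)..T, (x t - p) ^ 2 * deriv s t) +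
        ∫ t in (0:ℝ)..T, (y t - q) ^ 2 * deriv s t := by
      rw [← intervalIntegral.integral_add (hmul hsi (by fun_prop)) (hmul hsi (by fun_prop))]
      congr 1; ext t; rw [hD2]; ring
    rw [this]
    nlinarith [sq_nonneg r]
  have hI : ∫ t in (0:ℝ)..T, (x t * deriv y t - y t * deriv x t) =
      ∫ t in (0:ℝ)..T, ((x t - p) * deriv y t - (y t - q) * deriv x t) := by
    have e : ∀ t, (x t - p) * deriv y t - (y t - q) * deriv x t =
        (x t * deriv y t - y t * deriv x t) - (p * deriv y t - q * deriv x t) := fun t => by ring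
    simp only [e]
    rw [intervalIntegral.integral_sub ((hmul hyi hxc).sub (hmul hxi hyc))
      ((hyi.const_mul p).sub (hxi.const_mul q)),
      intervalIntegral.integral_sub (hyi.const_mul p) (hxi.const_mul q),
      intervalIntegral.integral_const_mul, intervalIntegral.integral_const_mul, hxI', hyI']
    ring
  set I := ∫ t in (0:ℝ)..T, (x t * deriv y t - y t * deriv x t) with hIdef
  have hdef : 2 * r * I + ∫ t in (0:ℝ)..T, (r - D t) ^ 2 * deriv s t ≤ 2 * r ^ 2 * L := by
    have h1 : 2 * r * I + ∫ t in (0:ℝ)..T, (r - D t) ^ 2 * deriv s t ≤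
        ∫ t in (0:ℝ)..T, (r ^ 2 * deriv s t + D t ^ 2 * deriv s t) := by
      have i1 := (hmul hyi (f := fun t => x t - p) (by fun_prop)).sub
        (hmul hxi (f := fun t => y t - q) (by fun_prop))
      have i2 := hmul hsi (f := fun t => (r - D t) ^ 2) (by fun_prop)
      rw [hI, ← intervalIntegral.integral_const_mul,
        ← intervalIntegral.integral_add (i1.const_mul _) i2]
      apply intervalIntegral.integral_mono_ae hT.le ((i1.const_mul _).add i2)
        ((hsi.const_mul _).add (hmul hsi (by fun_prop)))
      filter_upwards [hc, hxys] with t h1 h2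
      have h3 : 0 < deriv s t := hc0.trans_le h1
      have hD0 : 0 ≤ D t := sqrt_nonneg _
      have hcs : (x t - p) * deriv y t - (y t - q) * deriv x t ≤ D t * deriv s t := by
        apply le_of_sq_le_sq _ (by positivity) 
        rw [mul_pow, hD2]
        have : ((x t - p) ^ 2 + (y t - q) ^ 2) * (deriv x t ^ 2 + deriv y t ^ 2) ≤
          ((x t - p) ^ 2 + (y t - q) ^ 2) * deriv s t ^ 2 := by gcongr
        nlinarith [sq_nonneg ((x t - p) * deriv x t + (y t - q) * deriv y t)]
      have hcs2 := mul_le_mul_of_nonneg_left hcs (show 0 ≤ 2 * r by positivity)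
      change 2 * r * _ + _ ≤ _
      linear_combination hcs2
    rw [intervalIntegral.integral_add (hsi.const_mul _) (hmul hsi (by fun_prop)),
      intervalIntegral.integral_const_mul, hsI'] at h1
    linarith
  have hpos : 0 ≤ ∫ t in (0:ℝ)..T, (r - D t) ^ 2 * deriv s t := by
    apply intervalIntegral.integral_nonneg_of_ae hT.le
    filter_upwards [hc] with t h1
    have h3 : 0 < deriv s t := hc0.trans_le h1
    change 0 ≤ (r - D t) ^ 2 * deriv s t
    positivity
  have hrL : L ^ 2 / (2 * π) = r * L := by rw [hr]; ring
  rw [hrL]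
  constructor
  · refine le_of_mul_le_mul_left (a := 2 * r) ?_ (by positivity)
    linear_combination hdef + hpos
  · intro heq
    refine ⟨p, q, ?_⟩
    have hz : ∫ t in (0:ℝ)..T, (r - D t) ^ 2 * deriv s t ≤ 0 := by
      rw [heq] at hdef; linear_combination hdef
    have hz2 : ∫ t in (0:ℝ)..T, c * (r - D t) ^ 2 ≤ 0 := by
      refine le_trans ?_ hz
      apply intervalIntegral.integral_mono_ae hT.le
        (Continuous.intervalIntegrable (by fun_prop) _ _) (hmul hsi (by fun_prop))
      filter_upwards [hc] with t h1
      nlinarith [sq_nonneg (r - D t)]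
    have hz3 : ∀ t ∈ Icc 0 T, D t = r := by
      by_contra! hcon
      obtain ⟨t, ht, hne⟩ := hcon
      have : 0 < ∫ t in (0:ℝ)..T, c * (r - D t) ^ 2 := by
        apply intervalIntegral.integral_pos hT (by fun_prop)
        · intro t _; positivity
        · exact ⟨t, ht, by have := sub_ne_zero.2 hne.symm; positivity⟩
      linarith
    intro t
    have hDT : Function.Periodic D T := fun t => by simp only [D, hxT, hyT]
    obtain ⟨t', ht', he⟩ := hDT.exists_mem_Ico₀ hT t
    rw [← hD2, he, hz3 t' ⟨ht'.1, ht'.2.le⟩]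

open Set Filter Topology in
lemma iso_radial {K : Set ℂ} (hKc : IsCompact K) (hKv : Convex ℝ K) (h0 : K ∈ 𝓝 (0:ℂ)) :
    ∃ (ρ : ℝ → ℝ) (C : NNReal) (r₀ R : ℝ), LipschitzWith C ρ ∧ 0 < r₀ ∧ (∀ t, r₀ ≤ ρ t) ∧
      (∀ t, ρ t ≤ R) ∧ (∀ t, ρ (t + 2 * π) = ρ t) ∧
      (∀ t r : ℝ, 0 ≤ r → ((r : ℂ) * Complex.exp ((t : ℂ) * Complex.I) ∈ K ↔ r ≤ ρ t)) ∧
      (∀ t r : ℝ, 0 ≤ r → ((r : ℂ) * Complex.exp ((t : ℂ) * Complex.I) ∈ frontier K ↔ r = ρ t)) := by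
  have habs : Absorbent ℝ K := absorbent_nhds_zero h0
  obtain ⟨M, hM0, hM⟩ : ∃ M > 0, K ⊆ closedBall (0:ℂ) M := by
    obtain ⟨M, hM⟩ := hKc.isBounded.subset_closedBall 0
    exact ⟨max M 1, by positivity, hM.trans (closedBall_subset_closedBall (le_max_left _ _))⟩
  obtain ⟨C, hC⟩ := hKv.lipschitz_gauge h0
  obtain ⟨E, hE⟩ : ∃ E : NNReal, LipschitzWith E (fun t : ℝ => Complex.exp (t * Complex.I)) := by
    refine ⟨1, lipschitzWith_of_nnnorm_deriv_le ?_ ?_⟩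
    · fun_prop
    · intro t
      have : HasDerivAt (fun t : ℝ => Complex.exp (t * Complex.I))
        (Complex.exp (t * Complex.I) * (1 * Complex.I)) t :=
        ((Complex.ofRealCLM.hasDerivAt (x := t)).mul_const Complex.I).cexp
      rw [this.deriv, ← NNReal.coe_le_coe]
      simp [Complex.norm_exp_ofReal_mul_I]
  let g : ℝ → ℝ := fun t => gauge K (Complex.exp (t * Complex.I))
  have hg : LipschitzWith (C * E) g := hC.comp hE
  have hlow : ∀ t, 1 / M ≤ g t := fun t => by
    have := le_gauge_of_subset_closedBall (x := Complex.exp (t * Complex.I)) habs hM0.le hM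
    rwa [Complex.norm_exp_ofReal_mul_I] at this
  have hgpos : ∀ t, 0 < g t := fun t => lt_of_lt_of_le (by positivity) (hlow t)
  have hgper : ∀ t, g (t + 2 * π) = g t := fun t => by
    simp only [g]
    congr 1
    push_cast
    rw [add_mul, Complex.exp_add, Complex.exp_two_pi_mul_I, mul_one]
  obtain ⟨G, hG0, hG⟩ : ∃ G > 0, ∀ t, g t ≤ G := by
    obtain ⟨G, hG⟩ := (isCompact_sphere (0:ℂ) 1).exists_bound_of_continuousOn
      hC.continuous.continuousOn
    refine ⟨max G 1, by positivity, fun t => le_max_of_le_left ?_⟩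
    exact (le_abs_self _).trans (hG _ (by simp [Complex.norm_exp_ofReal_mul_I]))
  have hgr : ∀ t r : ℝ, 0 ≤ r → gauge K ((r : ℂ) * Complex.exp ((t : ℂ) * Complex.I)) = r * g t := by
    intro t r hr
    have := gauge_smul_of_nonneg (s := K) hr (Complex.exp (t * Complex.I))
    rwa [Complex.real_smul, smul_eq_mul] at this
  refine ⟨fun t => (g t)⁻¹, Real.toNNReal (M * M * (C * E)), G⁻¹, M, ?_, by positivity, ?_, ?_, ?_, ?_, ?_⟩
  · apply LipschitzWith.of_dist_le_mul
    intro a b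
    rw [Real.coe_toNNReal _ (by positivity)]
    have h1 := hg.dist_le_mul b a
    rw [Real.dist_eq] at h1 ⊢
    rw [inv_sub_inv (hgpos a).ne' (hgpos b).ne', abs_div, abs_of_pos (mul_pos (hgpos a) (hgpos b)),
      div_le_iff₀ (mul_pos (hgpos a) (hgpos b))]
    have h2 : 1 ≤ M * M * (g a * g b) := by
      have ha := hlow a
      have hb := hlow b
      rw [div_le_iff₀' hM0] at ha hb
      nlinarith
    rw [dist_comm b a] at h1
    calc |g b - g a| ≤ ((C * E : NNReal) : ℝ) * dist a b := h1
      _ ≤ (((C * E : NNReal) : ℝ) * dist a b) * (M * M * (g a * g b)) :=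
        le_mul_of_one_le_right (by positivity) h2
      _ = _ := by push_cast; ring
  · exact fun t => inv_anti₀ (hgpos t) (hG t)
  · intro t
    have := inv_anti₀ (by positivity) (hlow t)
    simpa using this
  · intro t; simp only [hgper]
  · intro t r hr
    conv_lhs => rw [← hKc.isClosed.closure_eq]
    rw [← gauge_le_one_iff_mem_closure hKv h0, hgr t r hr, ← le_div_iff₀ (hgpos t), one_div]
  · intro t r hr
    rw [← gauge_eq_one_iff_mem_frontier hKv h0, hgr t r hr, ← eq_div_iff (hgpos t).ne', one_div]

open Set Filter Topology in
lemma iso_area {K : Set ℂ} (hKc : IsClosed K) {ρ : ℝ → ℝ} (hρ : Continuous ρ) (hpos : ∀ t, 0 < ρ t)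
    (hper : ∀ t, ρ (t + 2 * π) = ρ t)
    (hK : ∀ t r : ℝ, 0 ≤ r → ((r : ℂ) * Complex.exp ((t : ℂ) * Complex.I) ∈ K ↔ r ≤ ρ t)) :
    (volume K).toReal = ∫ t in (0:ℝ)..(2 * π), ρ t ^ 2 / 2 := by
  have hm : MeasurableSet K := hKc.measurableSet
  have h1 := Complex.lintegral_comp_polarCoord_symm (K.indicator 1)
  rw [lintegral_indicator_one hm, polarCoord_target] at h1
  have hcont : Continuous (fun p : ℝ × ℝ => (p.1 : ℂ) * Complex.exp ((p.2 : ℂ) * Complex.I)) := by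
    fun_prop
  have h2 : ∀ p : ℝ × ℝ, Complex.polarCoord.symm p
      = (p.1 : ℂ) * Complex.exp ((p.2 : ℂ) * Complex.I) := fun p => by
    rw [Complex.polarCoord_symm_apply, Complex.exp_mul_I]
    push_cast; rfl
  simp only [h2] at h1
  have hmeas : Measurable (fun p : ℝ × ℝ => ENNReal.ofReal p.1 • K.indicator (1 : ℂ → ENNReal)
      ((p.1 : ℂ) * Complex.exp ((p.2 : ℂ) * Complex.I))) := by
    exact Measurable.smul (by fun_prop : Measurable fun p : ℝ × ℝ => ENNReal.ofReal p.1)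
      ((measurable_one.indicator hm).comp hcont.measurable)
  rw [Measure.volume_eq_prod, ← Measure.prod_restrict, lintegral_prod_symm _ hmeas.aemeasurable] at h1
  have h3 : ∀ t : ℝ, ∫⁻ r in Ioi (0:ℝ), ENNReal.ofReal r • K.indicator (1 : ℂ → ENNReal)
      ((r : ℂ) * Complex.exp ((t : ℂ) * Complex.I)) = ENNReal.ofReal (ρ t ^ 2 / 2) := by
    intro t
    have : ∫⁻ r in Ioi (0:ℝ), ENNReal.ofReal r • K.indicator (1 : ℂ → ENNReal)
      ((r : ℂ) * Complex.exp ((t : ℂ) * Complex.I)) =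
        ∫⁻ r in Ioi (0:ℝ), (Iic (ρ t)).indicator (fun r => ENNReal.ofReal r) r := by
      refine setLIntegral_congr_fun measurableSet_Ioi (fun r hr => ?_)
      by_cases h : r ≤ ρ t
      · rw [indicator_of_mem ((hK t r (le_of_lt hr)).2 h), indicator_of_mem (by exact h)]; simp
      · rw [indicator_of_notMem (fun h' => h ((hK t r (le_of_lt hr)).1 h')), indicator_of_notMem (by exact h)]; simp
    rw [this, lintegral_indicator measurableSet_Iic, Measure.restrict_restrict measurableSet_Iic,
      Iic_inter_Ioi, ← ofReal_integral_eq_lintegral_ofReal,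
      ← intervalIntegral.integral_of_le (hpos t).le, integral_id]
    · simp
    · exact (continuous_id.integrableOn_Icc).mono_set Ioc_subset_Icc_self
    · exact (ae_restrict_iff' measurableSet_Ioc).2 (Eventually.of_forall fun r hr => hr.1.le)
  simp only [h3] at h1
  have hper' : Function.Periodic (fun t => ρ t ^ 2 / 2) (2 * π) := fun t => by simp only [hper]
  have h4 := hper'.intervalIntegral_add_eq 0 (-π)
  rw [zero_add, show -π + 2 * π = π by ring] at h4
  rw [h4, ← h1, intervalIntegral.integral_of_le (by linarith [Real.pi_pos]),
    integral_Ioc_eq_integral_Ioo, ← ofReal_integral_eq_lintegral_ofReal, ENNReal.toReal_ofReal]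
  · exact integral_nonneg fun t => by positivity
  · exact ((by fun_prop : Continuous (fun t => ρ t ^ 2 / 2)).integrableOn_Icc).mono_set Ioo_subset_Icc_self
  · exact Eventually.of_forall fun t => by positivity

open Set Filter Topology in
lemma iso_chord {γ : ℝ → ℂ} (hγ : Continuous γ) {a b : ℝ} (hab : a ≤ b) :
    edist (γ b) (γ a) ≤ μH[1] (γ '' Ico a b) := by
  have hl : LipschitzWith 1 (fun z : ℂ => dist z (γ a)) := LipschitzWith.dist_left (γ a)
  have h1 := hl.hausdorffMeasure_image_le (d := 1) zero_le_one (γ '' Ico a b)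
  rw [ENNReal.coe_one, ENNReal.one_rpow, one_mul, hausdorffMeasure_real] at h1
  refine le_trans ?_ h1
  have h2 := intermediate_value_Ico hab (f := fun t => dist (γ t) (γ a)) (by fun_prop)
  rw [dist_self] at h2
  rw [image_image]
  refine le_trans ?_ (measure_mono h2)
  rw [Real.volume_Ico, sub_zero, edist_dist]

open Set Filter Topology in
lemma iso_variation_le {γ : ℝ → ℂ} (hγ : Continuous γ) {a b : ℝ} (hi : InjOn γ (Ico a b)) :
    eVariationOn γ (Icc a b) ≤ μH[1] (γ '' Ico a b) := by
  refine iSup_le ?_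
  rintro ⟨n, u, hu, hus⟩
  have hsub : ∀ i, Ico (u i) (u (i+1)) ⊆ Ico a b := fun i =>
    Ico_subset_Ico (hus i).1 (hus (i+1)).2
  calc ∑ i ∈ Finset.range n, edist (γ (u (i + 1))) (γ (u i))
      ≤ ∑ i ∈ Finset.range n, μH[1] (γ '' Ico (u i) (u (i+1))) :=
        Finset.sum_le_sum fun i _ => iso_chord hγ (hu (Nat.le_succ i))
    _ = μH[1] (⋃ i ∈ Finset.range n, γ '' Ico (u i) (u (i+1))) := by
        rw [measure_biUnion_finset]
        · intro i _ j _ hij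
          have h := hu.pairwise_disjoint_on_Ico_succ hij
          rw [Function.onFun, Set.disjoint_left]
          rintro _ ⟨p, hp, rfl⟩ ⟨q, hq, hqp⟩
          have hpq : q = p := hi (hsub j hq) (hsub i hp) hqp
          subst hpq
          exact Set.disjoint_left.1 h hp hq
        · intro i _
          exact measurableSet_Ico.image_of_continuousOn_injOn hγ.continuousOn (hi.mono (hsub i))
    _ ≤ _ := measure_mono (iUnion₂_subset fun i _ => image_mono (hsub i))

open Set Filter Topology in
lemma iso_arclength {γ : ℝ → ℂ} {C : NNReal} (hγ : LipschitzWith C γ) {T : ℝ} (hT : 0 ≤ T)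
    (hper : ∀ t, γ (t + T) = γ t) :
    ∃ s : ℝ → ℝ, LipschitzWith C s ∧ (∀ a b, a ≤ b → ‖γ b - γ a‖ ≤ s b - s a) ∧
      (∀ t, s (t + T) = s t + (eVariationOn γ (Icc 0 T)).toReal) := by
  have hbv : LocallyBoundedVariationOn γ univ := hγ.locallyBoundedVariationOn univ
  have hsub : ∀ a b, variationOnFromTo γ univ 0 b - variationOnFromTo γ univ 0 a
      = variationOnFromTo γ univ a b := fun a b =>
    variationOnFromTo.sub_right hbv (mem_univ _) (mem_univ _) (mem_univ _)
  have hle : ∀ a b, a ≤ b → variationOnFromTo γ univ a b = (eVariationOn γ (Icc a b)).toReal :=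
    fun a b hab => by rw [variationOnFromTo.eq_of_le _ _ hab, univ_inter]
  have hfin : ∀ a b, eVariationOn γ (Icc a b) ≠ ⊤ := fun a b => by
    have := hbv a b (mem_univ _) (mem_univ _)
    rwa [univ_inter] at this
  have hup : ∀ a b, a ≤ b → (eVariationOn γ (Icc a b)).toReal ≤ C * (b - a) := by
    intro a b hab
    have h1 := hγ.lipschitzOnWith (s := univ).comp_eVariationOn_le (g := id) (s := Icc a b)
      (mapsTo_univ _ _)
    have h2 : eVariationOn (id : ℝ → ℝ) (Icc a b) ≤ ENNReal.ofReal (b - a) := by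
      have := (monotoneOn_id (s := Icc a b)).eVariationOn_eq (left_mem_Icc.2 hab) (right_mem_Icc.2 hab)
      simp
    have h3 : eVariationOn γ (Icc a b) ≤ C * ENNReal.ofReal (b - a) :=
      h1.trans (by gcongr)
    have h4 := ENNReal.toReal_mono (by finiteness) h3
    rwa [ENNReal.toReal_mul, ENNReal.toReal_ofReal (by linarith), ENNReal.coe_toReal] at h4
  refine ⟨variationOnFromTo γ univ 0, ?_, ?_, ?_⟩
  · have key : ∀ a b, a ≤ b → dist (variationOnFromTo γ univ 0 a) (variationOnFromTo γ univ 0 b)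
        ≤ C * dist a b := by
      intro a b hab
      rw [dist_comm, Real.dist_eq, hsub, hle a b hab, abs_of_nonneg ENNReal.toReal_nonneg, dist_comm,
        Real.dist_eq, abs_of_nonneg (by linarith)]
      exact hup a b hab
    apply LipschitzWith.of_dist_le_mul
    intro a b
    rcases le_total a b with h | h
    · exact key a b h
    · rw [dist_comm, dist_comm a b]; exact key b a h
  · intro a b hab
    rw [hsub, hle a b hab, ← dist_eq_norm, dist_edist]
    exact ENNReal.toReal_mono (hfin a b)
      (eVariationOn.edist_le _ (right_mem_Icc.2 hab) (left_mem_Icc.2 hab))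
  · intro t
    have h1 := variationOnFromTo.comp_eq_of_monotoneOn γ (t := univ) (fun u : ℝ => u + T)
      (fun x _ y _ h => by simpa using h) (x := 0) (y := t) (mem_univ _) (mem_univ _)
    have h2 : γ ∘ (fun u : ℝ => u + T) = γ := funext hper
    have h3 : (fun u : ℝ => u + T) '' univ = univ := by
      rw [image_univ]; exact (add_right_surjective T).range_eq
    rw [h2, h3] at h1
    have h4 := variationOnFromTo.add hbv (mem_univ 0) (mem_univ T) (mem_univ (t+T))
    simp only [zero_add] at h1
    rw [← h4, h1, hle 0 T hT, add_comm]

open Set Filter Topology in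
lemma iso_deriv_sq {x y s : ℝ → ℝ} {t : ℝ} (hx : DifferentiableAt ℝ x t)
    (hy : DifferentiableAt ℝ y t) (hs : DifferentiableAt ℝ s t)
    (h : ∀ b, (x b - x t)^2 + (y b - y t)^2 ≤ (s b - s t)^2) :
    deriv x t ^ 2 + deriv y t ^ 2 ≤ deriv s t ^ 2 := by
  have h1 := hasDerivAt_iff_tendsto_slope.1 hx.hasDerivAt
  have h2 := hasDerivAt_iff_tendsto_slope.1 hy.hasDerivAt
  have h3 := hasDerivAt_iff_tendsto_slope.1 hs.hasDerivAt
  refine le_of_tendsto_of_tendsto ((h1.pow 2).add (h2.pow 2)) (h3.pow 2) ?_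
  refine Eventually.of_forall fun b => ?_
  simp only [slope_def_field, div_pow]
  rw [← add_div]
  exact div_le_div_of_nonneg_right (h b) (by positivity)

open Set Filter Topology in
lemma iso_ball {K : Set ℂ} (h0 : K ∈ 𝓝 (0:ℂ)) {ρ : ℝ → ℝ} (hpos : ∀ t, 0 < ρ t)
    (hK : ∀ t r : ℝ, 0 ≤ r → ((r : ℂ) * Complex.exp ((t : ℂ) * Complex.I) ∈ K ↔ r ≤ ρ t))
    {w : ℂ} {R : ℝ} (hR : 0 ≤ R)
    (hw : ∀ t : ℝ, ‖(ρ t : ℂ) * Complex.exp ((t : ℂ) * Complex.I) - w‖ = R) :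
    0 < R ∧ K = closedBall w R := by
  have hmem : ∀ t : ℝ, (ρ t : ℂ) * Complex.exp ((t : ℂ) * Complex.I) ∈ closedBall w R := fun t => by
    rw [mem_closedBall, dist_eq_norm, hw t]
  have hconv : Convex ℝ (closedBall w R) := convex_closedBall w R
  have hz : ∀ z : ℂ, z = (‖z‖ : ℂ) * Complex.exp ((z.arg : ℂ) * Complex.I) := fun z =>
    (Complex.norm_mul_exp_arg_mul_I z).symm
  have h00 : (0:ℂ) ∈ closedBall w R := by
    have h1 := hmem 0
    have h2 := hmem π
    rw [Complex.exp_pi_mul_I] at h2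
    simp only [Complex.ofReal_zero, zero_mul, Complex.exp_zero, mul_one] at h1
    have hp : 0 < ρ 0 + ρ π := add_pos (hpos _) (hpos _)
    have := hconv h1 h2 (a := ρ π / (ρ 0 + ρ π)) (b := ρ 0 / (ρ 0 + ρ π))
      (div_nonneg (hpos _).le hp.le) (div_nonneg (hpos _).le hp.le) (by field_simp; ring)
    convert this using 1
    simp only [Complex.real_smul]
    push_cast
    ring
  have hsub : K ⊆ closedBall w R := by
    intro z hzK
    rw [hz z] at hzK
    have hle := (hK z.arg ‖z‖ (norm_nonneg z)).1 hzK
    have hp := hpos z.arg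
    have := hconv h00 (hmem z.arg) (a := 1 - ‖z‖ / ρ z.arg) (b := ‖z‖ / ρ z.arg)
      (by rw [sub_nonneg, div_le_one hp]; exact hle) (by positivity) (by ring)
    convert this using 1
    rw [smul_zero, zero_add, Complex.real_smul, ← mul_assoc, ← Complex.ofReal_mul,
      div_mul_cancel₀ _ hp.ne']
    exact hz z
  have hintr : (0:ℂ) ∈ interior (closedBall w R) :=
    interior_mono hsub (mem_interior_iff_mem_nhds.2 h0)
  have hball : interior (closedBall w R) = ball w R := by
    exact interior_closedBall' w R
  refine ⟨?_, hsub.antisymm ?_⟩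
  · rw [hball] at hintr
    exact pos_of_mem_ball hintr
  · intro z hzB
    rw [hz z, hK _ _ (norm_nonneg z)]
    by_contra! hlt
    have hp := hpos z.arg
    have hn : 0 < ‖z‖ := hp.trans hlt
    have := hconv.combo_interior_self_mem_interior hintr hzB (a := 1 - ρ z.arg / ‖z‖)
      (b := ρ z.arg / ‖z‖) (by rw [sub_pos, div_lt_one hn]; exact hlt) (by positivity) (by ring)
    rw [smul_zero, zero_add, hball, mem_ball, dist_eq_norm] at this
    have h2 : (ρ z.arg / ‖z‖) • z = (ρ z.arg : ℂ) * Complex.exp ((z.arg : ℂ) * Complex.I) := by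
      conv_lhs => rw [hz z]
      rw [Complex.real_smul, ← mul_assoc, ← Complex.ofReal_mul]
      simp only [norm_mul, Complex.norm_real, norm_norm, Complex.norm_exp_ofReal_mul_I, mul_one]
      rw [div_mul_cancel₀ _ hn.ne', ← hz z]
    rw [h2, hw] at this
    exact lt_irrefl _ this

lemma iso_exp_lip : LipschitzWith 1 (fun t : ℝ => Complex.exp ((t : ℂ) * Complex.I)) := by
  refine lipschitzWith_of_nnnorm_deriv_le ?_ ?_
  · fun_prop
  · intro t
    have : HasDerivAt (fun t : ℝ => Complex.exp (t * Complex.I))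
      (Complex.exp (t * Complex.I) * (1 * Complex.I)) t :=
      ((Complex.ofRealCLM.hasDerivAt (x := t)).mul_const Complex.I).cexp
    rw [this.deriv, ← NNReal.coe_le_coe]
    simp

lemma iso_exp_add (t : ℝ) : Complex.exp (((t + 2 * π : ℝ) : ℂ) * Complex.I)
    = Complex.exp ((t : ℂ) * Complex.I) := by
  push_cast
  rw [add_mul, Complex.exp_add, Complex.exp_two_pi_mul_I, mul_one]

open Set Filter Topology in
lemma iso_gamma_inj {ρ : ℝ → ℝ} (hpos : ∀ t, 0 < ρ t) :
    InjOn (fun t : ℝ => (ρ t : ℂ) * Complex.exp ((t : ℂ) * Complex.I)) (Ico 0 (2 * π)) := by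
  intro a ha b hb hab
  simp only at hab
  have hn := congrArg norm hab
  simp only [norm_mul, Complex.norm_real, Complex.norm_exp_ofReal_mul_I, mul_one, Real.norm_eq_abs,
    abs_of_pos (hpos _)] at hn
  rw [hn] at hab
  have h2 := mul_left_cancel₀ (by exact_mod_cast (hpos b).ne') hab
  obtain ⟨n, hn⟩ := Complex.exp_eq_exp_iff_exists_int.1 h2
  have h3 : (a : ℂ) = ((b + n * (2 * π) : ℝ) : ℂ) := by
    apply mul_right_cancel₀ Complex.I_ne_zero
    rw [hn]; push_cast; ring
  have h4 : a = b + n * (2 * π) := by exact_mod_cast h3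
  have hpi := Real.pi_pos
  have h5 : n = 0 := by
    have l1 : (n : ℝ) < 1 := by
      by_contra! h
      nlinarith [ha.1, ha.2, hb.1, hb.2]
    have l2 : (-1 : ℝ) < n := by
      by_contra! h
      nlinarith [ha.1, ha.2, hb.1, hb.2]
    have l1' : n < 1 := by exact_mod_cast l1
    have l2' : -1 < n := by exact_mod_cast l2
    omega
  rw [h4, h5]; simp

open Set Filter Topology in
lemma iso_complex {K : Set ℂ} (hKc : IsCompact K) (hKv : Convex ℝ K) (h0 : K ∈ 𝓝 (0:ℂ)) :
    4 * π * (volume K).toReal ≤ (μH[1] (frontier K)).toReal ^ 2 ∧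
    ((μH[1] (frontier K)).toReal ^ 2 = 4 * π * (volume K).toReal →
      ∃ (c : ℂ) (r : ℝ), 0 < r ∧ K = closedBall c r) := by
  obtain ⟨ρ, C, r₀, R, hρ, hr₀, hr₀ρ, hρR, hper, hK, hfr⟩ := iso_radial hKc hKv h0
  have hpos : ∀ t, 0 < ρ t := fun t => hr₀.trans_le (hr₀ρ t)
  have hR0 : 0 < R := (hpos 0).trans_le (hρR 0)
  have hpi := Real.pi_pos
  set γ : ℝ → ℂ := fun t => (ρ t : ℂ) * Complex.exp ((t : ℂ) * Complex.I) with hγdef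
  have hre : ∀ t, (γ t).re = ρ t * cos t := fun t => by
    simp [hγdef, Complex.exp_ofReal_mul_I_re]
  have him : ∀ t, (γ t).im = ρ t * sin t := fun t => by
    simp [hγdef, Complex.exp_ofReal_mul_I_im]
  have hγ : LipschitzWith (C + R.toNNReal) γ := by
    apply LipschitzWith.of_dist_le_mul
    intro a b
    have h1 := hρ.dist_le_mul a b
    have h2 := iso_exp_lip.dist_le_mul a b
    rw [dist_eq_norm] at h2
    rw [dist_eq_norm, Real.norm_eq_abs] at h1
    have e : γ a - γ b = ((ρ a - ρ b : ℝ) : ℂ) * Complex.exp ((a : ℂ) * Complex.I)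
        + (ρ b : ℂ) * (Complex.exp ((a : ℂ) * Complex.I) - Complex.exp ((b : ℂ) * Complex.I)) := by
      simp only [hγdef]; push_cast; ring
    rw [dist_eq_norm, e]
    refine (norm_add_le _ _).trans ?_
    rw [norm_mul, norm_mul, Complex.norm_real, Complex.norm_real, Complex.norm_exp_ofReal_mul_I,
      mul_one, Real.norm_eq_abs, Real.norm_eq_abs, abs_of_pos (hpos b)]
    push_cast
    rw [Real.coe_toNNReal _ hR0.le, add_mul]
    have h3 : ρ b * ‖Complex.exp ((a : ℂ) * Complex.I) - Complex.exp ((b : ℂ) * Complex.I)‖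
        ≤ R * dist a b := by
      refine mul_le_mul (hρR b) ?_ (norm_nonneg _) hR0.le
      simpa using h2
    linarith
  have hγper : ∀ t, γ (t + 2 * π) = γ t := fun t => by
    simp only [hγdef, hper, iso_exp_add]
  have hγinj : InjOn γ (Ico 0 (2 * π)) := iso_gamma_inj hpos
  have hγfr : ∀ t, γ t ∈ frontier K := fun t => (hfr t _ (hpos t).le).2 rfl
  have hfrsub : frontier K ⊆ γ '' Icc (-π) π := by
    intro z hz
    rw [← Complex.norm_mul_exp_arg_mul_I z, hfr _ _ (norm_nonneg z)] at hz
    refine ⟨z.arg, ⟨(Complex.neg_pi_lt_arg z).le, Complex.arg_le_pi z⟩, ?_⟩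
    simp only [hγdef]
    rw [← hz, Complex.norm_mul_exp_arg_mul_I]
  have hfin : μH[1] (frontier K) ≠ ⊤ := by
    refine ne_top_of_le_ne_top ?_ ((measure_mono hfrsub).trans
      (hγ.hausdorffMeasure_image_le zero_le_one _))
    rw [hausdorffMeasure_real, Real.volume_Icc]
    finiteness
  obtain ⟨s, hs, hsγ, hsT⟩ := iso_arclength hγ (by positivity) hγper
  set L := (eVariationOn γ (Icc 0 (2 * π))).toReal with hL
  have hL0 : 0 ≤ L := ENNReal.toReal_nonneg
  have hLP : L ≤ (μH[1] (frontier K)).toReal := by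
    refine ENNReal.toReal_mono hfin ((iso_variation_le hγ.continuous hγinj).trans (measure_mono ?_))
    rintro _ ⟨t, _, rfl⟩
    exact hγfr t
  have hx : LipschitzWith (C + R.toNNReal) (fun t => (γ t).re) := by
    apply LipschitzWith.of_dist_le_mul
    intro a b
    refine le_trans ?_ (hγ.dist_le_mul a b)
    rw [Real.dist_eq, dist_eq_norm, ← Complex.sub_re]
    exact Complex.abs_re_le_norm _
  have hy : LipschitzWith (C + R.toNNReal) (fun t => (γ t).im) := by
    apply LipschitzWith.of_dist_le_mul
    intro a b
    refine le_trans ?_ (hγ.dist_le_mul a b)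
    rw [Real.dist_eq, dist_eq_norm, ← Complex.sub_im]
    exact Complex.abs_im_le_norm _
  have hmono : Monotone s := fun a b hab => by
    have := hsγ a b hab
    linarith [norm_nonneg (γ b - γ a)]
  have hsq : ∀ a b, ((γ b).re - (γ a).re)^2 + ((γ b).im - (γ a).im)^2 ≤ (s b - s a)^2 := by
    intro a b
    have e : ∀ a b, ((γ b).re - (γ a).re)^2 + ((γ b).im - (γ a).im)^2 = ‖γ b - γ a‖^2 := by
      intro a b
      rw [← Complex.normSq_eq_norm_sq, Complex.normSq_apply, Complex.sub_re, Complex.sub_im]; ring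
    rw [e]
    rcases le_total a b with h | h
    · exact pow_le_pow_left₀ (norm_nonneg _) (hsγ a b h) 2
    · have := pow_le_pow_left₀ (norm_nonneg _) (hsγ b a h) 2
      rw [norm_sub_rev]
      calc _ ≤ _ := this
        _ = _ := by ring
  have hder : ∀ᵐ t, deriv (fun t => (γ t).re) t ^ 2 + deriv (fun t => (γ t).im) t ^ 2
      ≤ deriv s t ^ 2 := by
    filter_upwards [hx.ae_differentiableAt_real, hy.ae_differentiableAt_real,
      hs.ae_differentiableAt_real] with t h1 h2 h3
    exact iso_deriv_sq h1 h2 h3 (fun b => hsq t b)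
  have hdx : ∀ t, DifferentiableAt ℝ ρ t →
      deriv (fun t => (γ t).re) t = deriv ρ t * cos t - ρ t * sin t ∧
      deriv (fun t => (γ t).im) t = deriv ρ t * sin t + ρ t * cos t := by
    intro t ht
    simp only [hre, him]
    constructor
    · rw [(ht.hasDerivAt.fun_mul (Real.hasDerivAt_cos t)).deriv]; ring
    · rw [(ht.hasDerivAt.fun_mul (Real.hasDerivAt_sin t)).deriv]
  have hc : ∀ᵐ t, r₀ ≤ deriv s t := by
    filter_upwards [hder, hρ.ae_differentiableAt_real] with t h1 h2
    obtain ⟨e1, e2⟩ := hdx t h2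
    rw [e1, e2] at h1
    have h3 : 0 ≤ deriv s t := hmono.deriv_nonneg
    refine abs_le_of_sq_le_sq' ?_ h3 |>.2
    have h4 : (deriv ρ t * cos t - ρ t * sin t) ^ 2 + (deriv ρ t * sin t + ρ t * cos t) ^ 2
        = deriv ρ t ^ 2 + ρ t ^ 2 := by
      linear_combination (deriv ρ t ^ 2 + ρ t ^ 2) * sin_sq_add_cos_sq t
    have h5 := pow_le_pow_left₀ hr₀.le (hr₀ρ t) 2
    linarith [sq_nonneg (deriv ρ t)]
  have hintr : ∫ t in (0:ℝ)..(2 * π), ((γ t).re * deriv (fun t => (γ t).im) t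
      - (γ t).im * deriv (fun t => (γ t).re) t) = 2 * (volume K).toReal := by
    rw [iso_area hKc.isClosed hρ.continuous hpos hper hK, ← intervalIntegral.integral_const_mul]
    refine intervalIntegral.integral_congr_ae ?_
    filter_upwards [hρ.ae_differentiableAt_real] with t h2 _
    obtain ⟨e1, e2⟩ := hdx t h2
    rw [e1, e2, hre, him]
    have := sin_sq_add_cos_sq t
    linear_combination (ρ t)^2 * this
  obtain ⟨hle, heq⟩ := iso_analytic hx hy hs (T := 2 * π) (L := L) (c := r₀) (by positivity) hr₀ hc
    (fun t => by simp only [hγper]) (fun t => by simp only [hγper]) hsT hder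
  rw [hintr] at hle heq
  have hsqLP : L ^ 2 ≤ (μH[1] (frontier K)).toReal ^ 2 := pow_le_pow_left₀ hL0 hLP 2
  rw [le_div_iff₀ (by positivity)] at hle
  refine ⟨by linarith, fun hPA => ?_⟩
  have h1 : 2 * (volume K).toReal = L ^ 2 / (2 * π) := by
    rw [eq_div_iff (by positivity)]
    linarith
  obtain ⟨p, q, hpq⟩ := heq h1
  refine ⟨⟨p, q⟩, L / (2 * π), iso_ball h0 hpos hK (by positivity) fun t => ?_⟩
  have h2 := hpq t
  have h3 : ‖γ t - ⟨p, q⟩‖ ^ 2 = (L / (2 * π)) ^ 2 := by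
    rw [← h2, ← Complex.normSq_eq_norm_sq, Complex.normSq_apply, Complex.sub_re, Complex.sub_im]; ring
  exact (pow_left_inj₀ (norm_nonneg _) (by positivity) two_ne_zero).1 h3

open Set Filter Topology in
lemma iso_disc (c : ℂ) {r : ℝ} (hr : 0 < r) :
    (μH[1] (frontier (closedBall c r))).toReal ^ 2 ≤ 4 * π * (volume (closedBall c r)).toReal := by
  have hpi := Real.pi_pos
  have hA : (volume (closedBall c r)).toReal = π * r ^ 2 := by
    rw [Complex.volume_closedBall]
    simp [ENNReal.toReal_ofReal hr.le]
    ring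
  have hl : LipschitzWith r.toNNReal
      (fun t : ℝ => c + (r : ℂ) * Complex.exp ((t : ℂ) * Complex.I)) := by
    apply LipschitzWith.of_dist_le_mul
    intro a b
    have h2 := iso_exp_lip.dist_le_mul a b
    rw [dist_eq_norm] at h2
    rw [dist_eq_norm, add_sub_add_left_eq_sub, ← mul_sub, norm_mul, Complex.norm_real,
      Real.norm_eq_abs, abs_of_pos hr, Real.coe_toNNReal _ hr.le]
    exact mul_le_mul_of_nonneg_left (by simpa using h2) hr.le
  have hsub : frontier (closedBall c r) ⊆
      (fun t : ℝ => c + (r : ℂ) * Complex.exp ((t : ℂ) * Complex.I)) '' Icc (-π) π := by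
    intro z hz
    rw [frontier_closedBall c hr.ne', mem_sphere, dist_eq_norm] at hz
    refine ⟨(z - c).arg, ⟨(Complex.neg_pi_lt_arg _).le, Complex.arg_le_pi _⟩, ?_⟩
    simp only
    rw [← hz, Complex.norm_mul_exp_arg_mul_I]
    ring
  have h1 := (measure_mono hsub).trans (hl.hausdorffMeasure_image_le (d := 1) zero_le_one _)
  rw [hausdorffMeasure_real, Real.volume_Icc, ENNReal.rpow_one] at h1
  have h2 := ENNReal.toReal_mono (by finiteness) h1
  rw [ENNReal.toReal_mul, ENNReal.coe_toReal, Real.coe_toNNReal _ hr.le,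
    ENNReal.toReal_ofReal (by linarith)] at h2
  rw [hA]
  have h3 := pow_le_pow_left₀ ENNReal.toReal_nonneg h2 2
  calc _ ≤ _ := h3
    _ = _ := by ring

/-- The classical isoperimetric inequality in the Euclidean plane:
`P_K² − 4π·A_K ≥ 0`, with equality iff `K` is a closed disc of positive radius. -/
theorem isoperimetric_inequality_euclidean (K : Set (EuclideanSpace ℝ (Fin 2)))
    (hKcomp : IsCompact K) (hKconv : Convex ℝ K) (hKint : (interior K).Nonempty) :
    euclPerim K ^ 2 - 4 * π * euclArea K ≥ 0 ∧
      (euclPerim K ^ 2 - 4 * π * euclArea K = 0 ↔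
        ∃ (c : EuclideanSpace ℝ (Fin 2)) (r : ℝ), 0 < r ∧ K = closedBall c r) := by
  obtain ⟨p, hp⟩ := hKint
  let e : EuclideanSpace ℝ (Fin 2) ≃ₗᵢ[ℝ] ℂ := Complex.orthonormalBasisOneI.repr.symm
  let f : EuclideanSpace ℝ (Fin 2) ≃ᵢ ℂ := e.toIsometryEquiv.trans (IsometryEquiv.addLeft (-(e p)))
  have hf : ∀ x, f x = -(e p) + e x := fun x => rfl
  have hvol : ∀ S : Set (EuclideanSpace ℝ (Fin 2)), MeasurableSet S →
      (volume (f '' S)) = volume S := by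
    intro S hS
    have hmp : MeasurePreserving f.symm (volume : Measure ℂ) volume := by
      have h1 : MeasurePreserving (fun z : ℂ => e p + z) volume volume :=
        measurePreserving_add_left volume (e p)
      have h2 := e.symm.measurePreserving.comp h1
      have h3 : ⇑f.symm = ⇑e.symm ∘ fun z : ℂ => e p + z := by
        funext z
        apply f.injective
        rw [f.apply_symm_apply, hf]
        simp
      rw [h3]
      exact h2
    rw [← hmp.measure_preimage hS.nullMeasurableSet, f.preimage_symm]
  have hper : ∀ S : Set (EuclideanSpace ℝ (Fin 2)), μH[1] (frontier (f '' S)) = μH[1] (frontier S) := by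
    intro S
    have := f.toHomeomorph.image_frontier S
    rw [IsometryEquiv.coe_toHomeomorph] at this
    rw [← this, f.hausdorffMeasure_image]
  have hcomp : IsCompact (f '' K) := hKcomp.image f.continuous
  have hconv : Convex ℝ (f '' K) := by
    have h1 := (hKconv.is_linear_image e.toLinearEquiv.toLinearMap.isLinear).translate (-(e p))
    rw [Set.image_image] at h1
    exact h1
  have h0 : f '' K ∈ nhds (0:ℂ) := by
    have h1 : f p = 0 := by simp [hf]
    rw [← h1]
    exact f.toHomeomorph.isOpenMap.image_mem_nhds (mem_interior_iff_mem_nhds.1 hp)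
  obtain ⟨hle, heq⟩ := iso_complex hcomp hconv h0
  rw [hvol K hKcomp.isClosed.measurableSet, hper] at hle heq
  unfold euclPerim euclArea
  refine ⟨by linarith, fun h => ?_, ?_⟩
  · obtain ⟨c, r, hr, hcr⟩ := heq (by linarith)
    refine ⟨f.symm c, r, hr, ?_⟩
    rw [← f.symm.image_closedBall, ← hcr, f.image_symm, Set.preimage_image_eq _ f.injective]
  · rintro ⟨c, r, hr, rfl⟩
    have h1 := iso_disc (f c) hr
    rw [← f.image_closedBall, hvol _ isClosed_closedBall.measurableSet, hper] at h1
    linarith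
end
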